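/- arXiv:1307.2183 — 4 statements merged into one kernel-verified Lean document; each statement's English description precedes it below -/
import Mathlib

section
/- Let n ≥ 2. For every matrix A in the Lorentz group O(n,1), the image under A of the equatorial sphere of de Sitter space meets the equatorial sphere itself; that is, there exists x ∈ ℝ^{n+1} with x_{n+1} = 0 and x₁² + ⋯ + xₙ² = 1 such that the vector A·x also satisfies (A·x)_{n+1} = 0 (and hence, since A preserves the quadratic form, (A·x)₁² + ⋯ + (A·x)ₙ² = 1). -/
open Matrix

/-- The Lorentz form matrix `η = diag(1,…,1,−1)` on `ℝ^{n+1}`: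
`n` entries `+1` followed by one entry `−1`. -/
def lorentzForm (n : ℕ) : Matrix (Fin (n + 1)) (Fin (n + 1)) ℝ :=
  Matrix.diagonal (fun i => if i = Fin.last n then (-1 : ℝ) else 1)

/-- **Calabi–Markus key lemma.**  For `n ≥ 2` and any `A ∈ O(n,1)` (i.e. `Aᵀ η A = η`),
the image under `A` of the equatorial sphere `{x : x_{n+1} = 0, x₁² + ⋯ + xₙ² = 1}` of
de Sitter space meets the equatorial sphere: there is a point `x` of the equatorial sphere
whose image `A·x` again has last coordinate `0`. -/
theorem equatorial_sphere_meets_its_image (n : ℕ) (hn : 2 ≤ n)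
    (A : Matrix (Fin (n + 1)) (Fin (n + 1)) ℝ)
    (hA : Aᵀ * lorentzForm n * A = lorentzForm n) :
    ∃ x : Fin (n + 1) → ℝ,
      x (Fin.last n) = 0 ∧
      (∑ i : Fin n, x i.castSucc ^ 2) = 1 ∧
      (A.mulVec x) (Fin.last n) = 0 := by
  obtain ⟨m, rfl⟩ : ∃ m, n = m + 2 := ⟨n - 2, by omega⟩
  obtain ⟨u, v, h1, h2⟩ : ∃ u v : ℝ, u ^ 2 + v ^ 2 = 1 ∧
      A (Fin.last (m + 2)) 0 * u + A (Fin.last (m + 2)) 1 * v = 0 := by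
    generalize A (Fin.last (m + 2)) 0 = a
    generalize A (Fin.last (m + 2)) 1 = b
    by_cases h : a ^ 2 + b ^ 2 = 0
    · have ha : a = 0 := by nlinarith [sq_nonneg a, sq_nonneg b]
      have hb : b = 0 := by nlinarith [sq_nonneg a, sq_nonneg b]
      exact ⟨1, 0, by norm_num, by simp [ha]⟩
    · have hp : 0 ≤ a ^ 2 + b ^ 2 := by positivity
      refine ⟨b / √(a ^ 2 + b ^ 2), -a / √(a ^ 2 + b ^ 2), ?_, by ring⟩
      rw [div_pow, div_pow, Real.sq_sqrt hp]
      field_simp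
      ring
  refine ⟨Fin.cons u (Fin.cons v (fun _ => 0)), ?_, ?_, ?_⟩
  · rw [← Fin.succ_last, Fin.cons_succ, ← Fin.succ_last, Fin.cons_succ]
  · rw [Fin.sum_univ_succ, Fin.sum_univ_succ]
    simp only [Fin.castSucc_zero, Fin.cons_zero, ← Fin.succ_castSucc, Fin.cons_succ]
    simpa using h1
  · rw [Matrix.mulVec, dotProduct, Fin.sum_univ_succ, Fin.sum_univ_succ]
    simp only [Fin.cons_zero, Fin.cons_succ]
    simpa using h2
end

section
/- (Calabi–Markus) Let n ≥ 2 and let Γ be a subgroup of O(n,1) whose action by matrix-vector multiplication on de Sitter space dS^n = {x ∈ ℝ^{n+1} : x₁² + ⋯ + xₙ² − x_{n+1}² = 1} is properly discontinuous. Then Γ is finite. -/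
open Matrix

/-- De Sitter space `dS^n = {x ∈ ℝ^{n+1} : x₁² + ⋯ + xₙ² − x_{n+1}² = 1}`. -/
def deSitter (n : ℕ) : Set (Fin (n + 1) → ℝ) :=
  {x | (∑ i : Fin n, x i.castSucc ^ 2) - x (Fin.last n) ^ 2 = 1}

lemma lorentz_quad (n : ℕ) (x : Fin (n + 1) → ℝ) :
    x ⬝ᵥ (lorentzForm n *ᵥ x) = (∑ i : Fin n, x i.castSucc ^ 2) - x (Fin.last n) ^ 2 := by
  simp only [lorentzForm, dotProduct, Matrix.mulVec_diagonal, Fin.sum_univ_castSucc]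
  simp only [if_true, (Fin.castSucc_lt_last _).ne, if_false]
  rw [sub_eq_add_neg]
  congr 1
  · exact Finset.sum_congr rfl fun i _ => by ring
  · ring

lemma exists_unit_orth (a b : ℝ) : ∃ c s : ℝ, c ^ 2 + s ^ 2 = 1 ∧ a * c + b * s = 0 := by
  by_cases h : a ^ 2 + b ^ 2 = 0
  · have ha : a = 0 := by nlinarith [sq_nonneg a, sq_nonneg b]
    have hb : b = 0 := by nlinarith [sq_nonneg a, sq_nonneg b]
    exact ⟨1, 0, by norm_num, by simp [ha, hb]⟩
  · have hp : 0 ≤ a ^ 2 + b ^ 2 := by positivity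
    have hs := Real.sq_sqrt hp
    have hne : Real.sqrt (a ^ 2 + b ^ 2) ≠ 0 := by
      intro h0
      rw [h0] at hs
      apply h
      linarith
    refine ⟨b / Real.sqrt (a ^ 2 + b ^ 2), -a / Real.sqrt (a ^ 2 + b ^ 2), ?_, ?_⟩
    · rw [div_pow, div_pow, hs]
      field_simp
      ring
    · ring

lemma isCompact_equator (n : ℕ) :
    IsCompact {x : Fin (n + 1) → ℝ | x ∈ deSitter n ∧ x (Fin.last n) = 0} := by
  apply IsCompact.of_isClosed_subset (isCompact_Icc (a := fun _ : Fin (n + 1) => (-1 : ℝ))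
    (b := fun _ => (1 : ℝ)))
  · apply IsClosed.inter
    · exact isClosed_eq (by fun_prop) (by fun_prop)
    · exact isClosed_eq (by fun_prop) (by fun_prop)
  · rintro x ⟨hx, h0⟩
    have hx' : (∑ i : Fin n, x i.castSucc ^ 2) - x (Fin.last n) ^ 2 = 1 := hx
    rw [h0] at hx'
    have key : ∀ i, -1 ≤ x i ∧ x i ≤ 1 := by
      intro i
      refine Fin.lastCases ?_ (fun j => ?_) i
      · rw [h0]; norm_num
      · have := Finset.single_le_sum (f := fun i : Fin n => x i.castSucc ^ 2)
          (fun i _ => sq_nonneg _) (Finset.mem_univ j)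
        apply abs_le.mp
        apply (sq_le_one_iff_abs_le_one _).mp
        linarith
    exact ⟨fun i => (key i).1, fun i => (key i).2⟩

/-- **Calabi–Markus.**  For `n ≥ 2`, any subgroup `Γ` of `O(n,1)` acting properly
discontinuously on de Sitter space `dS^n` (by matrix-vector multiplication) is finite. -/
theorem calabi_markus (n : ℕ) (hn : 2 ≤ n)
    (Γ : Subgroup (Matrix.GeneralLinearGroup (Fin (n + 1)) ℝ))
    (hΓ : ∀ γ ∈ Γ, (γ : Matrix (Fin (n + 1)) (Fin (n + 1)) ℝ)ᵀ * lorentzForm n * γ = lorentzForm n)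
    (hpd : ∀ K L : Set (Fin (n + 1) → ℝ), K ⊆ deSitter n → L ⊆ deSitter n →
      IsCompact K → IsCompact L →
      {γ : Γ | ∃ x ∈ K,
        ((γ : Matrix.GeneralLinearGroup (Fin (n + 1)) ℝ) :
            Matrix (Fin (n + 1)) (Fin (n + 1)) ℝ).mulVec x ∈ L}.Finite) :
    (Γ : Set (Matrix.GeneralLinearGroup (Fin (n + 1)) ℝ)).Finite := by
  have h := hpd {x | x ∈ deSitter n ∧ x (Fin.last n) = 0} {x | x ∈ deSitter n ∧ x (Fin.last n) = 0}
    (fun x hx => hx.1) (fun x hx => hx.1) (isCompact_equator n) (isCompact_equator n)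
  refine (h.image (fun γ : Γ => (γ : Matrix.GeneralLinearGroup (Fin (n + 1)) ℝ))).subset ?_
  intro γ hγ
  refine ⟨⟨γ, hγ⟩, ?_, rfl⟩
  set A : Matrix (Fin (n + 1)) (Fin (n + 1)) ℝ := (γ : Matrix (Fin (n + 1)) (Fin (n + 1)) ℝ) with hA
  have hAη : Aᵀ * lorentzForm n * A = lorentzForm n := hΓ γ hγ
  let i : Fin n := ⟨0, by omega⟩
  let j : Fin n := ⟨1, by omega⟩
  have hij : i ≠ j := by simp [i, j]
  obtain ⟨c, s, hcs, horth⟩ :=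
    exists_unit_orth (A (Fin.last n) i.castSucc) (A (Fin.last n) j.castSucc)
  let x : Fin (n + 1) → ℝ := Pi.single i.castSucc c + Pi.single j.castSucc s
  have hx0 : x (Fin.last n) = 0 := by
    simp [x, Pi.single_apply, (Fin.castSucc_lt_last _).ne']
  have hxS : x ∈ deSitter n := by
    show (∑ k : Fin n, x k.castSucc ^ 2) - x (Fin.last n) ^ 2 = 1
    rw [hx0]
    have : ∀ k : Fin n, x k.castSucc ^ 2
        = (if k = i then c ^ 2 else 0) + (if k = j then s ^ 2 else 0) := by
      intro k
      simp only [x, Pi.add_apply, Pi.single_apply, Fin.castSucc_inj]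
      by_cases h1 : k = i
      · subst h1; simp [hij]
      · simp [h1]
    rw [Finset.sum_congr rfl fun k _ => this k, Finset.sum_add_distrib]
    simp [hcs]
  refine ⟨x, ⟨hxS, hx0⟩, ?_, ?_⟩
  · show (∑ k : Fin n, (A *ᵥ x) k.castSucc ^ 2) - (A *ᵥ x) (Fin.last n) ^ 2 = 1
    have hq : (∑ k : Fin n, x k.castSucc ^ 2) - x (Fin.last n) ^ 2 = 1 := hxS
    rw [← lorentz_quad] at hq ⊢
    rw [← hq]
    conv_rhs => rw [← hAη]
    rw [← Matrix.mulVec_mulVec, ← Matrix.mulVec_mulVec, Matrix.dotProduct_mulVec x,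
      Matrix.vecMul_transpose]
  · show (A *ᵥ x) (Fin.last n) = 0
    simp only [x, Matrix.mulVec_add, Pi.add_apply, Matrix.mulVec_single]
    simpa [mul_comm] using horth
end

section
/- (Kulkarni; existence of compact anti-de Sitter space forms) For every n ≥ 1 there exists an infinite discrete subgroup Γ of O(2,2n) whose action by matrix-vector multiplication on the quadric X = {x ∈ ℝ^{2n+2} : x₁² + x₂² − x₃² − ⋯ − x_{2n+2}² = 1} is free, properly discontinuous and cocompact. Equivalently, the anti-de Sitter space AdS^{2n+1} = SO(1,2n)\SO(2,2n) admits a compact Clifford–Klein form. -/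
open Matrix

/-- The symmetric form matrix `η` of signature `(a, b)` on `ℝ^{a+b}`:
`a` entries `+1` followed by `b` entries `−1`. -/
def pseudoForm (a b : ℕ) : Matrix (Fin (a + b)) (Fin (a + b)) ℝ :=
  Matrix.diagonal (fun i => if (i : ℕ) < a then (1 : ℝ) else -1)

/-- The quadric `{x ∈ ℝ^{a+b} : x₁² + ⋯ + x_a² − x_{a+1}² − ⋯ − x_{a+b}² = 1}`. -/
def pseudoSphere (a b : ℕ) : Set (Fin (a + b) → ℝ) :=
  {x | ∑ i : Fin (a + b), (if (i : ℕ) < a then (1 : ℝ) else -1) * x i ^ 2 = 1}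


namespace AdSForm

/-- Minkowski's theorem on linear forms. -/
theorem minkowski_forms {ι : Type} [Fintype ι] [DecidableEq ι] (M : Matrix ι ι ℝ)
    (hM : M.det ≠ 0) (c : ι → ℝ) (hc : ∀ i, 0 < c i) (h : |M.det| < ∏ i, c i) :
    ∃ x : ι → ℤ, x ≠ 0 ∧ ∀ i, |(M *ᵥ (fun j => (x j : ℝ))) i| < c i := by
  classical
  let b := Pi.basisFun ℝ ι
  let s : Set (ι → ℝ) := Set.pi Set.univ (fun i => Set.Ioo (-c i) (c i))
  have hdet : LinearMap.det (Matrix.toLin' M) ≠ 0 := by rwa [LinearMap.det_toLin']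
  have hvol : MeasureTheory.volume (Matrix.toLin' M ⁻¹' s)
      = ENNReal.ofReal (|M.det|⁻¹ * ∏ i, (2 * c i)) := by
    rw [MeasureTheory.Measure.addHaar_preimage_linearMap _ hdet, LinearMap.det_toLin',
      Real.volume_pi_Ioo, ← ENNReal.ofReal_prod_of_nonneg, ← ENNReal.ofReal_mul (abs_nonneg _), abs_inv]
    · congr 3
      ext i; ring
    · intro i _; linarith [hc i]
  have hF : MeasureTheory.volume (ZSpan.fundamentalDomain b) = 1 := by
    rw [ZSpan.fundamentalDomain_pi_basisFun, MeasureTheory.volume_pi_pi]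
    simp
  have : Countable (Submodule.span ℤ (Set.range b)).toAddSubgroup :=
    inferInstanceAs (Countable (Submodule.span ℤ (Set.range b)))
  have key := MeasureTheory.exists_ne_zero_mem_lattice_of_measure_mul_two_pow_lt_measure
    (μ := MeasureTheory.volume) (s := Matrix.toLin' M ⁻¹' s)
    (ZSpan.isAddFundamentalDomain' b MeasureTheory.volume) ?_ ?_ ?_
  · obtain ⟨⟨x, hx⟩, hx0, hxs⟩ := key
    have hx' : x ∈ Submodule.span ℤ (Set.range b) := hx
    rw [Module.Basis.mem_span_iff_repr_mem] at hx'
    choose z hz using hx'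
    have hzx : (fun j => (z j : ℝ)) = x := by
      ext j
      have := hz j
      simpa [b] using this
    refine ⟨z, ?_, ?_⟩
    · rintro rfl
      apply hx0
      ext1
      simp [← hzx]
      rfl
    · intro i
      rw [hzx, abs_lt]
      have := hxs i (Set.mem_univ i)
      simpa using this
  · intro x hx i hi
    have := hx i hi
    simp only [Set.mem_Ioo, map_neg, Pi.neg_apply] at this ⊢
    constructor <;> linarith [this.1, this.2]
  · exact (convex_pi (fun i _ => convex_Ioo _ _)).linear_preimage _
  · rw [hF, one_mul, hvol, Finset.prod_mul_distrib]
    have h2 : (2 : ENNReal) ^ Module.finrank ℝ (ι → ℝ) = ENNReal.ofReal (2 ^ Fintype.card ι) := by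
      rw [ENNReal.ofReal_pow (by norm_num)]; simp
    have hd : 0 < |M.det| := abs_pos.mpr hM
    rw [h2, ENNReal.ofReal_lt_ofReal_iff_of_nonneg (by positivity)]
    simp only [Finset.prod_const, Finset.card_univ]
    rw [inv_mul_eq_div, lt_div_iff₀ hd]
    exact mul_lt_mul_of_pos_left h (by positivity)

/-- Short lattice vectors escape every hyperplane. -/
theorem short_vectors {ι : Type} [Fintype ι] [DecidableEq ι] (C δ : ℝ) (hC : 0 < C) (hδ : 0 < δ) :
    ∃ R : ℝ, 0 < R ∧ ∀ M : Matrix ι ι ℝ, M.det ≠ 0 → |M.det| ≤ C →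
      (∀ x : ι → ℤ, x ≠ 0 → ∃ i, δ ≤ |(M *ᵥ (fun j => (x j : ℝ))) i|) →
      ∀ f : ι → ℝ, f ≠ 0 → ∃ x : ι → ℤ,
        (∀ i, |(M *ᵥ (fun j => (x j : ℝ))) i| ≤ R) ∧
        f ⬝ᵥ (M *ᵥ (fun j => (x j : ℝ))) ≠ 0 := by
  classical
  set m : ℝ := ((Fintype.card ι : ℕ) : ℝ) with hm
  have hm0 : 0 ≤ m := by positivity
  set δ' := δ / (m + 1) with hδ'
  have hδ'0 : 0 < δ' := by positivity
  have hmδ : m * δ' < δ := by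
    rw [hδ']; rw [mul_div_assoc', div_lt_iff₀ (by positivity)]; nlinarith
  have hδδ : δ' ≤ δ := by
    rw [hδ']; exact div_le_self hδ.le (by linarith)
  set T := (C + 1) / δ' ^ (Fintype.card ι - 1) with hT
  have hT0 : 0 < T := by positivity
  refine ⟨T + δ, by positivity, ?_⟩
  intro M hM hMC hlow f hf
  obtain ⟨k, hk⟩ : ∃ k, f k ≠ 0 := by
    by_contra h; push Not at h; exact hf (funext h)
  obtain ⟨p, -, hp⟩ := Finset.exists_max_image Finset.univ (fun i => |f i|) ⟨k, Finset.mem_univ k⟩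
  have hfp : 0 < |f p| := lt_of_lt_of_le (abs_pos.mpr hk) (hp k (Finset.mem_univ k))
  have hfp' : f p ≠ 0 := abs_pos.mp hfp
  let c : ι → ℝ := fun i => f i / f p
  have hc1 : ∀ i, |c i| ≤ 1 := fun i => by
    simp only [c, abs_div]; exact (div_le_one hfp).mpr (hp i (Finset.mem_univ i))
  have hcp : c p = 1 := div_self hfp'
  let M' := M.updateRow p (∑ k, c k • M k)
  have hM' : M'.det = M.det := by
    simp only [M']; rw [Matrix.det_updateRow_sum, hcp, one_smul]
  let w : ι → ℝ := Function.update (fun _ => δ') p T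
  have hw : ∀ i, 0 < w i := by
    intro i; simp only [w, Function.update_apply]; split_ifs <;> assumption
  have hwp : ∏ i, w i = C + 1 := by
    simp only [w]
    rw [Finset.prod_update_of_mem (Finset.mem_univ p)]
    simp only [Finset.prod_const]
    rw [Finset.card_sdiff_of_subset (by simp)]
    simp only [Finset.card_univ, Finset.card_singleton]
    rw [hT, div_mul_cancel₀ _ (by positivity)]
  obtain ⟨x, hx0, hx⟩ := minkowski_forms M' (by rwa [hM']) w hw (by rw [hM', hwp]; linarith)
  set y := M *ᵥ (fun j => (x j : ℝ)) with hy
  have h1 : ∀ i, i ≠ p → |y i| < δ' := by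
    intro i hi
    have := hx i
    simp only [w, Function.update_apply, if_neg hi] at this
    convert this using 2
    simp [M', Matrix.mulVec, hy, Matrix.updateRow_ne hi]
  have h2 : (M' *ᵥ (fun j => (x j : ℝ))) p = c ⬝ᵥ y := by
    simp only [M', hy, Matrix.mulVec, Matrix.updateRow_self, dotProduct, Finset.sum_apply,
      Pi.smul_apply, smul_eq_mul, Finset.sum_mul, Finset.mul_sum]
    rw [Finset.sum_comm]
    simp only [mul_assoc]
  have h3 : |c ⬝ᵥ y| < T := by
    have := hx p
    rw [h2] at this
    simpa [w] using this
  have h4 : |y p - c ⬝ᵥ y| ≤ m * δ' := by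
    have : c ⬝ᵥ y = y p + ∑ i ∈ Finset.univ.erase p, c i * y i := by
      rw [dotProduct, ← Finset.add_sum_erase _ _ (Finset.mem_univ p), hcp, one_mul]
    rw [this, sub_add_cancel_left, abs_neg]
    calc _ ≤ ∑ i ∈ Finset.univ.erase p, |c i * y i| := Finset.abs_sum_le_sum_abs _ _
      _ ≤ ∑ i ∈ Finset.univ.erase p, δ' := by
          apply Finset.sum_le_sum
          intro i hi
          rw [abs_mul]
          have := h1 i (Finset.ne_of_mem_erase hi)
          nlinarith [hc1 i, abs_nonneg (c i), abs_nonneg (y i)]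
      _ ≤ ∑ i : ι, δ' := Finset.sum_le_sum_of_subset_of_nonneg (Finset.erase_subset _ _)
          (fun _ _ _ => hδ'0.le)
      _ = m * δ' := by simp [hm]
  have hfc : f ⬝ᵥ y = f p * (c ⬝ᵥ y) := by
    rw [dotProduct, dotProduct, Finset.mul_sum]
    apply Finset.sum_congr rfl
    intro i _
    simp only [c]; field_simp
  refine ⟨x, ?_, ?_⟩
  · intro i
    by_cases hi : i = p
    · subst hi
      have := abs_sub_abs_le_abs_sub (y i) (c ⬝ᵥ y)
      linarith
    · linarith [h1 i hi]
  · rw [← hy, hfc]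
    refine mul_ne_zero hfp' ?_
    intro h0
    obtain ⟨i, hi⟩ := hlow x hx0
    rw [← hy] at hi
    by_cases hip : i = p
    · subst hip
      rw [h0, sub_zero] at h4
      linarith
    · linarith [h1 i hip]


/-- Combinatorial data describing a complex structure on `ℝ^ι` and a form of signature `(2, *)`. -/
structure CD (ι : Type) [DecidableEq ι] where
  τ : ι → ι
  hτ : ∀ i, τ (τ i) = i
  s : ι → ℤ
  hs : ∀ i, s i * s i = 1
  hsτ : ∀ i, s (τ i) = - s i
  p : ι
  ε : ι → ℤ
  hε : ∀ i, ε i = if i = p ∨ i = τ p then 1 else -1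

namespace CD

set_option linter.unusedSectionVars false

variable {ι : Type} [Fintype ι] [DecidableEq ι] (c : CD ι)

theorem s_ne (i : ι) : c.s i ≠ 0 := by
  intro h; have := c.hs i; rw [h] at this; simp at this

theorem p_ne : c.p ≠ c.τ c.p := by
  intro h
  have := c.hsτ c.p
  rw [← h] at this
  exact c.s_ne c.p (by omega)

theorem ετ (i : ι) : c.ε (c.τ i) = c.ε i := by
  rw [c.hε, c.hε]
  have h1 : c.τ i = c.p ↔ i = c.τ c.p := by
    constructor
    · intro h; rw [← h, c.hτ]
    · intro h; rw [h, c.hτ]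
  have h2 : c.τ i = c.τ c.p ↔ i = c.p := by
    constructor
    · intro h; rw [← c.hτ i, h, c.hτ]
    · intro h; rw [h]
  simp only [h1, h2, or_comm]

theorem ε_sq (i : ι) : c.ε i * c.ε i = 1 := by
  rw [c.hε]; split_ifs <;> simp

/-- `τ` as an equivalence. -/
def τe : ι ≃ ι := ⟨c.τ, c.τ, c.hτ, c.hτ⟩

/-- The complex structure. -/
def J (A : Type) [CommRing A] : Matrix ι ι A :=
  Matrix.of fun i j => if j = c.τ i then (c.s i : A) else 0

theorem J_mulVec {A : Type} [CommRing A] (x : ι → A) (i : ι) :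
    (c.J A *ᵥ x) i = c.s i * x (c.τ i) := by
  simp [J, Matrix.mulVec, dotProduct]

theorem J_map {A B : Type} [CommRing A] [CommRing B] (f : A →+* B) :
    (c.J A).map f = c.J B := by
  ext i j
  simp only [J, Matrix.map_apply, Matrix.of_apply]
  split_ifs <;> simp

/-- The standard form. -/
def η : Matrix ι ι ℝ := Matrix.diagonal (fun i => (c.ε i : ℝ))

theorem η_mulVec (x : ι → ℝ) (i : ι) : (c.η *ᵥ x) i = c.ε i * x i := by
  simp [η, Matrix.mulVec_diagonal]

theorem η_T : c.ηᵀ = c.η := by simp [η]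

theorem η_sq : c.η * c.η = 1 := by
  rw [η, Matrix.diagonal_mul_diagonal, ← Matrix.diagonal_one]
  congr 1; ext i; exact_mod_cast c.ε_sq i

theorem JJ (x : ι → ℝ) : c.J ℝ *ᵥ (c.J ℝ *ᵥ x) = -x := by
  ext i
  rw [c.J_mulVec, c.J_mulVec, c.hτ, c.hsτ]
  have := c.hs i
  have h2 : (c.s i : ℝ) * c.s i = 1 := by exact_mod_cast this
  push_cast
  simp only [Pi.neg_apply]
  linear_combination (-x i) * h2

/-- The bilinear form. -/
def h (x y : ι → ℝ) : ℝ := ∑ i, c.ε i * x i * y i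

theorem h_eq (x y : ι → ℝ) : c.h x y = x ⬝ᵥ (c.η *ᵥ y) := by
  simp only [h, dotProduct, c.η_mulVec]
  apply Finset.sum_congr rfl; intros; ring

theorem h_eq' (x y : ι → ℝ) : c.h x y = (c.η *ᵥ x) ⬝ᵥ y := by
  simp only [h, dotProduct, c.η_mulVec]

theorem h_comm (x y : ι → ℝ) : c.h x y = c.h y x := by
  simp only [h]; apply Finset.sum_congr rfl; intros; ring

theorem h_add (x y : ι → ℝ) : c.h (x + y) (x + y) = c.h x x + 2 * c.h x y + c.h y y := by
  simp only [h, Finset.mul_sum, ← Finset.sum_add_distrib, Pi.add_apply]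
  apply Finset.sum_congr rfl; intros; ring

theorem h_JJ (x y : ι → ℝ) : c.h (c.J ℝ *ᵥ x) (c.J ℝ *ᵥ y) = c.h x y := by
  simp only [h, c.J_mulVec]
  rw [← Equiv.sum_comp c.τe (fun i => (c.ε i : ℝ) * x i * y i)]
  apply Finset.sum_congr rfl
  intro i _
  have h2 : (c.s i : ℝ) * c.s i = 1 := by exact_mod_cast c.hs i
  simp only [τe, Equiv.coe_fn_mk, c.ετ]
  linear_combination ((c.ε i : ℝ) * x (c.τ i) * y (c.τ i)) * h2

theorem h_J (x y : ι → ℝ) : c.h (c.J ℝ *ᵥ x) y = - c.h x (c.J ℝ *ᵥ y) := by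
  simp only [h, c.J_mulVec]
  rw [← Equiv.sum_comp c.τe (fun i => (c.ε i : ℝ) * x i * _), ← Finset.sum_neg_distrib]
  apply Finset.sum_congr rfl
  intro i _
  simp only [τe, Equiv.coe_fn_mk, c.ετ, c.hsτ, c.hτ]
  push_cast; ring

theorem h_J_self (x : ι → ℝ) : c.h x (c.J ℝ *ᵥ x) = 0 := by
  have := c.h_J x x
  rw [c.h_comm] at this
  linarith

/-- The negative indices. -/
def rest : Finset ι := Finset.univ.filter (fun i => ¬ (i = c.p ∨ i = c.τ c.p))

theorem sum_split (f : ι → ℝ) : ∑ i, c.ε i * f i =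
    f c.p + f (c.τ c.p) - ∑ i ∈ c.rest, f i := by
  rw [rest, ← Finset.sum_filter_add_sum_filter_not Finset.univ (fun i => (i = c.p ∨ i = c.τ c.p))]
  have h1 : Finset.univ.filter (fun i => (i = c.p ∨ i = c.τ c.p)) = {c.p, c.τ c.p} := by
    ext i; simp
  rw [sub_eq_add_neg, ← Finset.sum_neg_distrib]
  congr 1
  · rw [h1, Finset.sum_pair c.p_ne, c.ετ, c.hε]; simp
  · apply Finset.sum_congr rfl
    intro i hi
    rw [c.hε, if_neg (Finset.mem_filter.mp hi).2]; simp

theorem mem_rest (i : ι) : i ∈ c.rest ↔ c.ε i = -1 := by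
  rw [rest, Finset.mem_filter, c.hε]
  split_ifs with h <;> simp [h]

theorem sum_rest (f : ι → ℝ) : ∑ i ∈ c.rest, f (c.τ i) = ∑ i ∈ c.rest, f i := by
  apply Finset.sum_equiv c.τe
  · intro i; rw [c.mem_rest, c.mem_rest]; simp [τe, c.ετ]
  · intro i _; rfl

theorem cs_rest (x u : ι → ℝ) :
    (∑ i ∈ c.rest, x i * u i) ^ 2 + (∑ i ∈ c.rest, (c.J ℝ *ᵥ x) i * u i) ^ 2 ≤
      (∑ i ∈ c.rest, x i ^ 2) * (∑ i ∈ c.rest, u i ^ 2) := by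
  set a := ∑ i ∈ c.rest, x i * u i with ha
  set b := ∑ i ∈ c.rest, (c.J ℝ *ᵥ x) i * u i with hb
  have h1 : ∑ i ∈ c.rest, (c.J ℝ *ᵥ x) i ^ 2 = ∑ i ∈ c.rest, x i ^ 2 := by
    rw [← c.sum_rest (fun i => x i ^ 2)]
    apply Finset.sum_congr rfl
    intro i _
    have h2 : (c.s i : ℝ) * c.s i = 1 := by exact_mod_cast c.hs i
    rw [c.J_mulVec]
    linear_combination (x (c.τ i)) ^ 2 * h2
  have h2 : ∑ i ∈ c.rest, x i * (c.J ℝ *ᵥ x) i = 0 := by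
    have h3 := c.sum_rest (fun i => x i * (c.J ℝ *ᵥ x) i)
    have h4 : ∑ i ∈ c.rest, x (c.τ i) * (c.J ℝ *ᵥ x) (c.τ i) =
        - ∑ i ∈ c.rest, x i * (c.J ℝ *ᵥ x) i := by
      rw [← Finset.sum_neg_distrib]
      apply Finset.sum_congr rfl
      intro i _
      rw [c.J_mulVec, c.J_mulVec, c.hsτ, c.hτ]; push_cast; ring
    linarith
  have h3 := Finset.sum_mul_sq_le_sq_mul_sq c.rest (fun i => a * x i + b * (c.J ℝ *ᵥ x) i) u
  have h4 : ∑ i ∈ c.rest, (a * x i + b * (c.J ℝ *ᵥ x) i) * u i = a ^ 2 + b ^ 2 := by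
    have : a ^ 2 + b ^ 2 = a * a + b * b := by ring
    rw [this]
    conv_rhs => rw [ha, hb]
    rw [← ha, ← hb, Finset.mul_sum, Finset.mul_sum, ← Finset.sum_add_distrib]
    apply Finset.sum_congr rfl; intros; ring
  have h5 : ∑ i ∈ c.rest, (a * x i + b * (c.J ℝ *ᵥ x) i) ^ 2 =
      (a ^ 2 + b ^ 2) * ∑ i ∈ c.rest, x i ^ 2 := by
    have e : ∑ i ∈ c.rest, (a * x i + b * (c.J ℝ *ᵥ x) i) ^ 2 =
      a ^ 2 * (∑ i ∈ c.rest, x i ^ 2) + 2 * a * b * (∑ i ∈ c.rest, x i * (c.J ℝ *ᵥ x) i)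
        + b ^ 2 * (∑ i ∈ c.rest, (c.J ℝ *ᵥ x) i ^ 2) := by
      simp only [Finset.mul_sum, ← Finset.sum_add_distrib]
      apply Finset.sum_congr rfl; intros; ring
    rw [e, h1, h2]; ring
  rw [h4, h5] at h3
  by_cases hz : a ^ 2 + b ^ 2 = 0
  · rw [hz]
    exact mul_nonneg (Finset.sum_nonneg fun _ _ => sq_nonneg _)
      (Finset.sum_nonneg fun _ _ => sq_nonneg _)
  · have hpos : 0 < a ^ 2 + b ^ 2 := lt_of_le_of_ne (by positivity) (Ne.symm hz)
    nlinarith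

theorem rev_cs_aux (X U Y V c0 d0 a b : ℝ) (hX : X - Y = 1) (hY : 0 ≤ Y) (hV : 0 ≤ V)
    (h0 : c0 ^ 2 + d0 ^ 2 = X * U) (h1 : a ^ 2 + b ^ 2 ≤ Y * V) :
    U - V ≤ (c0 - a) ^ 2 + (d0 - b) ^ 2 := by
  rcases hY.eq_or_lt with rfl | hY
  · have ha : a = 0 := by nlinarith [sq_nonneg a, sq_nonneg b]
    have hb : b = 0 := by nlinarith [sq_nonneg a, sq_nonneg b]
    subst ha hb
    have : X = 1 := by linarith
    subst this
    nlinarith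
  · obtain rfl : X = 1 + Y := by linarith
    have e : Y * ((1 + Y) * ((c0 - a) ^ 2 + (d0 - b) ^ 2)) =
        (Y * c0 - (1 + Y) * a) ^ 2 + (Y * d0 - (1 + Y) * b) ^ 2
        + Y * (c0 ^ 2 + d0 ^ 2) - (1 + Y) * (a ^ 2 + b ^ 2) := by ring
    have h2 : Y * ((1 + Y) * (U - V)) ≤ Y * ((1 + Y) * ((c0 - a) ^ 2 + (d0 - b) ^ 2)) := by
      rw [e, h0]
      have := mul_le_mul_of_nonneg_left h1 (by linarith : 0 ≤ 1 + Y)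
      nlinarith [sq_nonneg (Y * c0 - (1 + Y) * a), sq_nonneg (Y * d0 - (1 + Y) * b)]
    have h3 := le_of_mul_le_mul_left h2 hY
    exact le_of_mul_le_mul_left h3 (by linarith)

/-- Reverse Cauchy-Schwarz inequality. -/
theorem rev_cs (x v : ι → ℝ) (hx : c.h x x = 1) :
    c.h v v ≤ c.h x v ^ 2 + c.h (c.J ℝ *ᵥ x) v ^ 2 := by
  have hh : ∀ y z : ι → ℝ, c.h y z = y c.p * z c.p + y (c.τ c.p) * z (c.τ c.p)
      - ∑ i ∈ c.rest, y i * z i := by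
    intro y z
    rw [← c.sum_split (fun i => y i * z i), h]
    apply Finset.sum_congr rfl; intros; ring
  rw [hh] at hx
  rw [hh v v, hh x v, hh (c.J ℝ *ᵥ x) v]
  have h1 := c.cs_rest x v
  have h2 : (c.s c.p : ℝ) * c.s c.p = 1 := by exact_mod_cast c.hs c.p
  simp only [pow_two] at h1
  refine rev_cs_aux (x c.p * x c.p + x (c.τ c.p) * x (c.τ c.p)) _ (∑ i ∈ c.rest, x i * x i) _ _ _ _ _ hx
    (Finset.sum_nonneg fun _ _ => mul_self_nonneg _)
    (Finset.sum_nonneg fun _ _ => mul_self_nonneg _) ?_ (by simpa only [pow_two] using h1)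
  rw [c.J_mulVec, c.J_mulVec, c.hτ, c.hsτ]
  push_cast
  linear_combination (x (c.τ c.p) * v c.p - x c.p * v (c.τ c.p)) ^ 2 * h2

/-- The majorant of the form attached to a point of the quadric. -/
def S (x : ι → ℝ) : Matrix ι ι ℝ :=
  (2 : ℝ) • vecMulVec (c.η *ᵥ x) (c.η *ᵥ x) +
  (2 : ℝ) • vecMulVec (c.η *ᵥ (c.J ℝ *ᵥ x)) (c.η *ᵥ (c.J ℝ *ᵥ x)) - c.η

theorem S_quad (x v : ι → ℝ) : v ⬝ᵥ (c.S x *ᵥ v) =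
    2 * c.h x v ^ 2 + 2 * c.h (c.J ℝ *ᵥ x) v ^ 2 - c.h v v := by
  rw [S, Matrix.sub_mulVec, Matrix.add_mulVec, Matrix.smul_mulVec, Matrix.smul_mulVec,
    Matrix.vecMulVec_mulVec, Matrix.vecMulVec_mulVec, dotProduct_sub, dotProduct_add,
    ← c.h_eq, ← c.h_eq', ← c.h_eq']
  simp only [dotProduct_smul, ← c.h_eq, smul_eq_mul, MulOpposite.smul_eq_mul_unop,
    MulOpposite.unop_op, c.h_comm v]
  ring

theorem S_bound (x v : ι → ℝ) (hx : c.h x x = 1) : |c.h v v| ≤ v ⬝ᵥ (c.S x *ᵥ v) := by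
  have := c.rev_cs x v hx
  rw [c.S_quad, abs_le]
  constructor <;> nlinarith [sq_nonneg (c.h x v), sq_nonneg (c.h (c.J ℝ *ᵥ x) v)]

theorem S_T (x : ι → ℝ) : (c.S x)ᵀ = c.S x := by
  simp [S, Matrix.transpose_vecMulVec, c.η_T]

theorem S_psd (x : ι → ℝ) (hx : c.h x x = 1) : (c.S x).PosSemidef := by
  refine Matrix.PosSemidef.of_dotProduct_mulVec_nonneg ?_ ?_
  · rw [Matrix.IsHermitian, Matrix.conjTranspose_eq_transpose_of_trivial, c.S_T]
  · intro v
    simpa using (abs_nonneg _).trans (c.S_bound x v hx)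

theorem S_mulVec (x v : ι → ℝ) : c.S x *ᵥ v = c.η *ᵥ ((2 * c.h x v) • x +
    (2 * c.h (c.J ℝ *ᵥ x) v) • (c.J ℝ *ᵥ x) - v) := by
  rw [S, Matrix.sub_mulVec, Matrix.add_mulVec, Matrix.smul_mulVec, Matrix.smul_mulVec,
    Matrix.vecMulVec_mulVec, Matrix.vecMulVec_mulVec, ← c.h_eq', ← c.h_eq', Matrix.mulVec_sub,
    Matrix.mulVec_add, Matrix.mulVec_smul, Matrix.mulVec_smul]
  ext i
  simp only [Pi.sub_apply, Pi.add_apply, Pi.smul_apply, smul_eq_mul,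
    MulOpposite.smul_eq_mul_unop, MulOpposite.unop_op]
  ring

theorem h_lin (y x z v : ι → ℝ) (a b : ℝ) :
    c.h y (a • x + b • z - v) = a * c.h y x + b * c.h y z - c.h y v := by
  simp only [h, Finset.mul_sum, ← Finset.sum_add_distrib, ← Finset.sum_sub_distrib, Pi.add_apply,
    Pi.sub_apply, Pi.smul_apply, smul_eq_mul]
  apply Finset.sum_congr rfl; intros; ring

theorem S_inv (x : ι → ℝ) (hx : c.h x x = 1) : c.S x * c.η * c.S x = c.η := by
  have h2 : c.h (c.J ℝ *ᵥ x) (c.J ℝ *ᵥ x) = 1 := by rw [c.h_JJ, hx]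
  have h3 := c.h_J_self x
  have h4 := h3
  rw [c.h_comm] at h4
  refine Matrix.ext_of_mulVec_single ?_
  intro i
  generalize (Pi.single i 1 : ι → ℝ) = v
  rw [← Matrix.mulVec_mulVec, ← Matrix.mulVec_mulVec, c.S_mulVec x v, Matrix.mulVec_mulVec _ c.η c.η,
    c.η_sq, Matrix.one_mulVec, c.S_mulVec, c.h_lin, c.h_lin, h2, h3, h4, hx]
  congr 1
  ext j
  simp only [Pi.sub_apply, Pi.add_apply, Pi.smul_apply, smul_eq_mul]
  ring

theorem S_equiv (x : ι → ℝ) (g : Matrix ι ι ℝ) (hg : gᵀ * c.η * g = c.η)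
    (hJ : g * c.J ℝ = c.J ℝ * g) : gᵀ * c.S (g *ᵥ x) * g = c.S x := by
  have e : ∀ y : ι → ℝ, gᵀ *ᵥ (c.η *ᵥ (g *ᵥ y)) = c.η *ᵥ y := by
    intro y
    rw [Matrix.mulVec_mulVec, Matrix.mulVec_mulVec, hg]
  have e2 : ∀ y : ι → ℝ, (c.η *ᵥ (g *ᵥ y)) ᵥ* g = c.η *ᵥ y := by
    intro y
    rw [← Matrix.mulVec_transpose, e]
  have e3 : c.J ℝ *ᵥ (g *ᵥ x) = g *ᵥ (c.J ℝ *ᵥ x) := by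
    rw [Matrix.mulVec_mulVec, Matrix.mulVec_mulVec, hJ]
  rw [S, S, e3, Matrix.mul_sub, Matrix.sub_mul, hg, Matrix.mul_add, Matrix.add_mul,
    Matrix.mul_smul, Matrix.mul_smul, Matrix.smul_mul, Matrix.smul_mul, Matrix.mul_vecMulVec,
    Matrix.mul_vecMulVec, Matrix.vecMulVec_mul, Matrix.vecMulVec_mul, e, e, e2, e2]

theorem S_trace (x : ι → ℝ) : (c.S x).trace = 4 * ∑ i, x i ^ 2 - ∑ i, (c.ε i : ℝ) := by
  have h1 : ∑ i, (c.J ℝ *ᵥ x) i ^ 2 = ∑ i, x i ^ 2 := by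
    rw [← Equiv.sum_comp c.τe (fun i => x i ^ 2)]
    apply Finset.sum_congr rfl
    intro i _
    have h2 : (c.s i : ℝ) * c.s i = 1 := by exact_mod_cast c.hs i
    rw [c.J_mulVec]
    simp only [τe, Equiv.coe_fn_mk]
    linear_combination (x (c.τ i)) ^ 2 * h2
  have h2 : ∀ y : ι → ℝ, (vecMulVec (c.η *ᵥ y) (c.η *ᵥ y)).trace = ∑ i, y i ^ 2 := by
    intro y
    simp only [Matrix.trace, Matrix.diag_apply, Matrix.vecMulVec_apply, c.η_mulVec]
    apply Finset.sum_congr rfl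
    intro i _
    have h2 : (c.ε i : ℝ) * c.ε i = 1 := by exact_mod_cast c.ε_sq i
    linear_combination (y i) ^ 2 * h2
  rw [S, Matrix.trace_sub, Matrix.trace_add, Matrix.trace_smul, Matrix.trace_smul, h2, h2, h1, η,
    Matrix.trace_diagonal]
  simp only [smul_eq_mul]; ring

theorem S_quad_J (x v : ι → ℝ) : (c.J ℝ *ᵥ v) ⬝ᵥ (c.S x *ᵥ (c.J ℝ *ᵥ v)) = v ⬝ᵥ (c.S x *ᵥ v) := by
  rw [c.S_quad, c.S_quad, c.h_JJ, c.h_JJ, c.h_comm x (c.J ℝ *ᵥ v), c.h_J, c.h_comm v]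
  ring

open scoped MatrixOrder Matrix.Norms.L2Operator in
theorem S_root (x : ι → ℝ) (hx : c.h x x = 1) :
    ∃ B : Matrix ι ι ℝ, Bᵀ * B = c.S x ∧ |B.det| = 1 := by
  obtain ⟨B, hB⟩ := CStarAlgebra.nonneg_iff_eq_star_mul_self.mp (c.S_psd x hx).nonneg
  rw [Matrix.star_eq_conjTranspose, Matrix.conjTranspose_eq_transpose_of_trivial] at hB
  refine ⟨B, hB.symm, ?_⟩
  have h1 := congrArg Matrix.det (c.S_inv x hx)
  have h2 := congrArg Matrix.det c.η_sq
  rw [hB] at h1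
  simp only [Matrix.det_mul, Matrix.det_transpose, Matrix.det_one] at h1 h2
  have h3 : (|B.det| ^ 2) ^ 2 = 1 := by
    rw [sq_abs]
    have : c.η.det ≠ 0 := by intro h; rw [h] at h2; simp at h2
    apply mul_right_cancel₀ this
    linear_combination h1
  have h4 : |B.det| ^ 2 = 1 := by
    rwa [pow_eq_one_iff_of_nonneg (by positivity) (by norm_num)] at h3
  rwa [pow_eq_one_iff_of_nonneg (by positivity) (by norm_num)] at h4

/-- Polarised bound of the form by the majorant. -/
theorem S_bound2 (x v w : ι → ℝ) (hx : c.h x x = 1) :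
    |c.h v w| ≤ 2 * (v ⬝ᵥ (c.S x *ᵥ v) + w ⬝ᵥ (c.S x *ᵥ w)) := by
  have h1 := c.S_bound x v hx
  have h2 := c.S_bound x w hx
  have h3 := c.S_bound x (v + w) hx
  have h4 := (abs_nonneg _).trans (c.S_bound x (v + (-1 : ℝ) • w) hx)
  have e1 := c.h_add v w
  have e2 : (v + w) ⬝ᵥ (c.S x *ᵥ (v + w)) + (v + (-1 : ℝ) • w) ⬝ᵥ (c.S x *ᵥ (v + (-1 : ℝ) • w))
      = 2 * (v ⬝ᵥ (c.S x *ᵥ v) + w ⬝ᵥ (c.S x *ᵥ w)) := by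
    simp only [Matrix.mulVec_add, Matrix.mulVec_smul, add_dotProduct, dotProduct_add,
      smul_dotProduct, dotProduct_smul, smul_eq_mul]
    ring
  rw [abs_le] at *
  constructor <;> linarith

end CD


/-- The ring `ℤ[√2]`. -/
abbrev R2 := Zsqrtd 2

/-- First real embedding. -/
noncomputable def σ : R2 →+* ℝ := Zsqrtd.lift ⟨√2, by simp⟩

/-- Second real embedding. -/
noncomputable def σ' : R2 →+* ℝ := Zsqrtd.lift ⟨-√2, by simp⟩

theorem σ_apply (r : R2) : σ r = r.re + r.im * √2 := rfl

theorem σ'_apply (r : R2) : σ' r = r.re + r.im * (-√2) := rfl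

theorem two_nonsq (n : ℤ) : (2 : ℤ) ≠ n * n := by
  intro h
  have h1 : n < 2 := by nlinarith
  have h2 : -2 < n := by nlinarith
  interval_cases n <;> omega

theorem σ_inj : Function.Injective σ := Zsqrtd.lift_injective _ two_nonsq

theorem σ'_inj : Function.Injective σ' := Zsqrtd.lift_injective _ two_nonsq

theorem σ_norm (r : R2) : σ r * σ' r = (r.norm : ℝ) := by
  rw [σ_apply, σ'_apply, Zsqrtd.norm_def]
  have : √2 * √2 = 2 := by simp
  push_cast
  linear_combination (- (r.im : ℝ) * r.im) * this

theorem small_eq_zero (r : R2) (h : |σ r| * |σ' r| < 1) : r = 0 := by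
  rw [← abs_mul, σ_norm] at h
  have h1 : |r.norm| < 1 := by exact_mod_cast h
  have h2 : r.norm = 0 := by rwa [Int.abs_lt_one_iff] at h1
  have h3 := σ_norm r
  rw [h2, Int.cast_zero, mul_eq_zero] at h3
  rcases h3 with h3 | h3
  · exact σ_inj (by simpa using h3)
  · exact σ'_inj (by simpa using h3)

theorem sqrt2_gt : (1 : ℝ) < √2 := by
  rw [Real.lt_sqrt (by norm_num)]; norm_num

theorem sqrt2_lt : √2 < (2 : ℝ) := by
  rw [Real.sqrt_lt' (by norm_num)]; norm_num

theorem finite_R2 (C : ℝ) : {r : R2 | |σ r| ≤ C ∧ |σ' r| ≤ C}.Finite := by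
  let K : ℤ := ⌈C⌉
  have hK : C ≤ K := Int.le_ceil C
  have hfin : ((Set.Icc (-K) K) ×ˢ (Set.Icc (-K) K)).Finite :=
    (Set.finite_Icc _ _).prod (Set.finite_Icc _ _)
  refine Set.Finite.of_finite_image (f := fun r : R2 => (r.re, r.im)) (hfin.subset ?_) ?_
  · rintro _ ⟨r, ⟨h1, h2⟩, rfl⟩
    rw [σ_apply, abs_le] at h1
    rw [σ'_apply, abs_le] at h2
    have hre : |(r.re : ℝ)| ≤ C := by rw [abs_le]; constructor <;> linarith [h1.1, h1.2, h2.1, h2.2]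
    have him : |(r.im : ℝ)| ≤ C := by
      have : |(r.im : ℝ) * √2| ≤ C := by rw [abs_le]; constructor <;> linarith [h1.1, h1.2, h2.1, h2.2]
      rw [abs_mul, abs_of_pos (by positivity : 0 < √2)] at this
      nlinarith [sqrt2_gt, abs_nonneg (r.im : ℝ)]
    have hre' : |r.re| ≤ K := by exact_mod_cast hre.trans hK
    have him' : |r.im| ≤ K := by exact_mod_cast him.trans hK
    exact ⟨abs_le.mp hre', abs_le.mp him'⟩
  · intro a _ b _ h
    simp only [Prod.mk.injEq] at h
    exact Zsqrtd.ext h.1 h.2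

theorem finite_mat {ι : Type} [Fintype ι] (C : ℝ) :
    {V : Matrix ι ι R2 | ∀ i j, |σ (V i j)| ≤ C ∧ |σ' (V i j)| ≤ C}.Finite := by
  have := Set.Finite.pi' (ι := ι) (fun _ => Set.Finite.pi' (ι := ι) (fun _ => finite_R2 C))
  exact this

theorem trace_lemma {ι : Type} [Fintype ι] [DecidableEq ι] (A B : Matrix ι ι ℝ)
    (hB : B.det ≠ 0) (h : Aᵀ * (Bᵀ * B) * A = Bᵀ * B) :
    |A.trace| ≤ Fintype.card ι ∧ (A.trace = Fintype.card ι → A = 1) := by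
  have hu : IsUnit B.det := isUnit_iff_ne_zero.mpr hB
  set O := B * A * B⁻¹ with hO
  have h1 : Oᵀ * O = 1 := by
    have e : Oᵀ * O = (B⁻¹)ᵀ * (Aᵀ * (Bᵀ * B) * A) * B⁻¹ := by
      simp only [hO, Matrix.transpose_mul, Matrix.mul_assoc]
    rw [e, h, Matrix.mul_assoc, Matrix.mul_assoc, Matrix.mul_nonsing_inv _ hu, Matrix.mul_one,
      ← Matrix.transpose_mul, Matrix.mul_nonsing_inv _ hu, Matrix.transpose_one]
  have ht : O.trace = A.trace := by
    rw [hO, Matrix.trace_mul_comm, ← Matrix.mul_assoc, Matrix.nonsing_inv_mul _ hu, Matrix.one_mul]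
  have hsum : ∀ X : Matrix ι ι ℝ, (Xᵀ * X).trace = ∑ j, ∑ i, X i j ^ 2 := by
    intro X
    simp only [Matrix.trace, Matrix.diag_apply, Matrix.mul_apply, Matrix.transpose_apply, pow_two]
  have hpos : ∀ X : Matrix ι ι ℝ, 0 ≤ (Xᵀ * X).trace := by
    intro X; rw [hsum]; positivity
  have e1 : ((O - 1)ᵀ * (O - 1)).trace = 2 * Fintype.card ι - 2 * A.trace := by
    rw [Matrix.transpose_sub, Matrix.transpose_one, Matrix.sub_mul, Matrix.mul_sub, h1,
      Matrix.one_mul, Matrix.mul_one, Matrix.trace_sub, Matrix.trace_sub, Matrix.trace_sub,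
      Matrix.trace_transpose, Matrix.trace_one, ht]
    ring
  have e2 : ((O + 1)ᵀ * (O + 1)).trace = 2 * Fintype.card ι + 2 * A.trace := by
    rw [Matrix.transpose_add, Matrix.transpose_one, Matrix.add_mul, Matrix.mul_add, h1,
      Matrix.one_mul, Matrix.mul_one, Matrix.trace_add, Matrix.trace_add, Matrix.trace_add,
      Matrix.trace_transpose, Matrix.trace_one, ht]
    ring
  have p1 := hpos (O - 1)
  have p2 := hpos (O + 1)
  refine ⟨by rw [abs_le]; constructor <;> linarith, ?_⟩
  intro hA
  rw [hA, sub_self, hsum, Finset.sum_eq_zero_iff_of_nonneg (fun _ _ => by positivity)] at e1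
  have hO1 : O = 1 := by
    ext i j
    have := e1 j (Finset.mem_univ j)
    rw [Finset.sum_eq_zero_iff_of_nonneg (fun _ _ => by positivity)] at this
    have := this i (Finset.mem_univ i)
    have := pow_eq_zero_iff (two_ne_zero) |>.mp this
    simpa [sub_eq_zero] using this
  have : A = B⁻¹ * O * B := by
    rw [hO, Matrix.mul_assoc B, ← Matrix.mul_assoc B⁻¹, Matrix.nonsing_inv_mul _ hu, Matrix.one_mul,
      Matrix.mul_assoc, Matrix.nonsing_inv_mul _ hu, Matrix.mul_one]
  rw [this, hO1, Matrix.mul_one, Matrix.nonsing_inv_mul _ hu]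

namespace CD

set_option linter.unusedSectionVars false

variable {ι : Type} [Fintype ι] [DecidableEq ι] (c : CD ι)

/-- Diagonal coefficients of the integral form. -/
def qc (i : ι) : R2 := if c.ε i = 1 then Zsqrtd.sqrtd else -1

/-- The integral form. -/
def Q : Matrix ι ι R2 := Matrix.diagonal c.qc

/-- Coefficients of the rescaling. -/
noncomputable def dc (i : ι) : ℝ := if c.ε i = 1 then √(√2) else 1

/-- The rescaling. -/
noncomputable def D : Matrix ι ι ℝ := Matrix.diagonal c.dc

/-- The inverse rescaling. -/
noncomputable def Di : Matrix ι ι ℝ := Matrix.diagonal (fun i => (c.dc i)⁻¹)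

theorem dc_ge (i : ι) : 1 ≤ c.dc i := by
  unfold dc; split_ifs
  · rw [Real.one_le_sqrt]; exact sqrt2_gt.le
  · exact le_rfl

theorem dc_le (i : ι) : c.dc i ≤ 2 := by
  unfold dc; split_ifs
  · rw [Real.sqrt_le_left (by norm_num)]; linarith [sqrt2_lt]
  · norm_num

theorem ε_cases (i : ι) : c.ε i = 1 ∨ c.ε i = -1 := by
  rw [c.hε]; split_ifs <;> simp

theorem σ_qc (i : ι) : σ (c.qc i) = c.ε i * (c.dc i * c.dc i) := by
  unfold qc dc
  rcases c.ε_cases i with h | h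
  · rw [if_pos h, if_pos h, h, Real.mul_self_sqrt (by positivity)]
    simp [σ_apply, Zsqrtd.sqrtd]
  · rw [if_neg (by omega), if_neg (by omega), h]
    simp

theorem σ'_qc (i : ι) : σ' (c.qc i) = - (c.dc i * c.dc i) := by
  unfold qc dc
  rcases c.ε_cases i with h | h
  · rw [if_pos h, if_pos h, Real.mul_self_sqrt (by positivity)]
    simp [σ'_apply, Zsqrtd.sqrtd]
  · rw [if_neg (by omega), if_neg (by omega)]
    simp

theorem D_Di : c.D * c.Di = 1 := by
  rw [D, Di, Matrix.diagonal_mul_diagonal, ← Matrix.diagonal_one]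
  congr 1; ext i; exact mul_inv_cancel₀ (by linarith [c.dc_ge i])

theorem Di_D : c.Di * c.D = 1 := by
  rw [D, Di, Matrix.diagonal_mul_diagonal, ← Matrix.diagonal_one]
  congr 1; ext i; exact inv_mul_cancel₀ (by linarith [c.dc_ge i])

theorem D_T : c.Dᵀ = c.D := by simp [D]
theorem Di_T : c.Diᵀ = c.Di := by simp [Di]

theorem Q_σ : c.Q.map σ = c.D * c.η * c.D := by
  rw [Q, D, η, Matrix.diagonal_mul_diagonal, Matrix.diagonal_mul_diagonal,
    Matrix.diagonal_map (map_zero σ)]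
  congr 1; ext i
  simp only [c.σ_qc]; ring

theorem Q_σ' : c.Q.map σ' = - (c.Dᵀ * c.D) := by
  rw [c.D_T, Q, D, Matrix.diagonal_mul_diagonal, Matrix.diagonal_map (map_zero σ'),
    Matrix.diagonal_neg]
  congr 1; ext i
  simp only [c.σ'_qc]

theorem D_det_ge : 1 ≤ c.D.det := by
  rw [D, Matrix.det_diagonal]
  calc (1 : ℝ) = ∏ _i : ι, 1 := by simp
    _ ≤ _ := Finset.prod_le_prod (fun _ _ => zero_le_one) (fun i _ => c.dc_ge i)

theorem dcτ (i : ι) : c.dc (c.τ i) = c.dc i := by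
  unfold dc; rw [c.ετ]

theorem D_J : c.D * c.J ℝ = c.J ℝ * c.D := by
  ext i j
  rw [D, Matrix.diagonal_mul, Matrix.mul_diagonal]
  simp only [J, Matrix.of_apply]
  split_ifs with h
  · rw [h, c.dcτ]; ring
  · simp

theorem Di_J : c.Di * c.J ℝ = c.J ℝ * c.Di := by
  calc c.Di * c.J ℝ = c.Di * (c.J ℝ * c.D) * c.Di := by
        rw [Matrix.mul_assoc, Matrix.mul_assoc, c.D_Di, Matrix.mul_one]
    _ = c.J ℝ * c.Di := by
        rw [← c.D_J, ← Matrix.mul_assoc, c.Di_D, Matrix.one_mul]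

/-- The embedding of integral matrices, rescaled. -/
noncomputable def Φ : Matrix ι ι R2 →* Matrix ι ι ℝ where
  toFun A := c.D * A.map σ * c.Di
  map_one' := by rw [Matrix.map_one _ (map_zero _) (map_one _), Matrix.mul_one, c.D_Di]
  map_mul' A B := by
    rw [Matrix.map_mul]
    calc _ = c.D * (A.map σ * 1 * B.map σ) * c.Di := by rw [Matrix.mul_one]
      _ = _ := by rw [← c.Di_D]; simp only [Matrix.mul_assoc]

theorem Φ_apply (A : Matrix ι ι R2) : c.Φ A = c.D * A.map σ * c.Di := rfl

/-- The arithmetic group. -/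
def Γ₀ (N : ℕ) : Subgroup (Matrix ι ι R2)ˣ where
  carrier := {A | (A : Matrix ι ι R2)ᵀ * c.Q * A = c.Q ∧ (A : Matrix ι ι R2) * c.J R2 = c.J R2 * A ∧
    ∃ Z : Matrix ι ι R2, (A : Matrix ι ι R2) = 1 + (N : R2) • Z}
  one_mem' := ⟨by simp, by simp, 0, by simp⟩
  mul_mem' := by
    rintro A B ⟨h1, h2, Z, hZ⟩ ⟨k1, k2, W, hW⟩
    refine ⟨?_, ?_, Z + W + (N : R2) • (Z * W), ?_⟩
    · rw [Units.val_mul, Matrix.transpose_mul]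
      calc _ = (B : Matrix ι ι R2)ᵀ * ((A : Matrix ι ι R2)ᵀ * c.Q * A) * B := by
            simp only [Matrix.mul_assoc]
        _ = _ := by rw [h1, k1]
    · rw [Units.val_mul, Matrix.mul_assoc, k2, ← Matrix.mul_assoc, h2, Matrix.mul_assoc]
    · rw [Units.val_mul, hZ, hW]
      simp only [Matrix.add_mul, Matrix.mul_add, Matrix.one_mul, Matrix.mul_one, Matrix.smul_mul,
        Matrix.mul_smul, smul_add]
      abel
  inv_mem' := by
    rintro A ⟨h1, h2, Z, hZ⟩
    have e1 : (A : Matrix ι ι R2) * (A⁻¹ : (Matrix ι ι R2)ˣ) = 1 := A.mul_inv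
    have e2 : ((A⁻¹ : (Matrix ι ι R2)ˣ) : Matrix ι ι R2) * A = 1 := A.inv_mul
    set A' : Matrix ι ι R2 := ((A⁻¹ : (Matrix ι ι R2)ˣ) : Matrix ι ι R2) with hA'
    refine ⟨?_, ?_, -(Z * A'), ?_⟩
    · rw [← hA']
      conv_lhs => rw [← h1]
      calc _ = (A'ᵀ * (A : Matrix ι ι R2)ᵀ) * c.Q * ((A : Matrix ι ι R2) * A') := by
            simp only [Matrix.mul_assoc]
        _ = _ := by rw [← Matrix.transpose_mul, e1]; simp
    · rw [← hA']
      calc A' * c.J R2 = A' * (c.J R2 * A) * A' := by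
            rw [Matrix.mul_assoc, Matrix.mul_assoc, e1, Matrix.mul_one]
        _ = _ := by rw [← h2, ← Matrix.mul_assoc, e2, Matrix.one_mul]
    · rw [← hA']
      have : (1 + (N : R2) • Z) * A' = 1 := by rw [← hZ, e1]
      rw [Matrix.add_mul, Matrix.one_mul, Matrix.smul_mul] at this
      rw [smul_neg, ← this]; abel

theorem Φ_form (A : Matrix ι ι R2) (h : Aᵀ * c.Q * A = c.Q) :
    (c.Φ A)ᵀ * c.η * c.Φ A = c.η := by
  have h1 := congrArg (fun X => X.map σ) h
  simp only [Matrix.map_mul, c.Q_σ, Matrix.transpose_map] at h1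
  rw [c.Φ_apply, Matrix.transpose_mul, Matrix.transpose_mul, c.D_T, c.Di_T]
  calc _ = c.Di * ((A.map σ)ᵀ * (c.D * c.η * c.D) * A.map σ) * c.Di := by
        simp only [Matrix.mul_assoc]
    _ = (c.Di * c.D) * c.η * (c.D * c.Di) := by
        rw [h1]; simp only [Matrix.mul_assoc]
    _ = c.η := by rw [c.Di_D, c.D_Di]; simp

theorem Φ_J (A : Matrix ι ι R2) (h : A * c.J R2 = c.J R2 * A) :
    c.Φ A * c.J ℝ = c.J ℝ * c.Φ A := by
  have h1 := congrArg (fun X => X.map σ) h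
  simp only [Matrix.map_mul, c.J_map] at h1
  rw [c.Φ_apply, Matrix.mul_assoc, c.Di_J, ← Matrix.mul_assoc, Matrix.mul_assoc c.D, h1,
    ← Matrix.mul_assoc, c.D_J]
  simp only [Matrix.mul_assoc]

theorem Φ_trace (A : Matrix ι ι R2) : (c.Φ A).trace = σ A.trace := by
  rw [c.Φ_apply, Matrix.trace_mul_comm, ← Matrix.mul_assoc, c.Di_D, Matrix.one_mul]
  simp [Matrix.trace, map_sum]

theorem Φ_bound (A : Matrix ι ι R2) (C : ℝ) (h : ∀ i j, |c.Φ A i j| ≤ C) (i j : ι) :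
    |σ (A i j)| ≤ 2 * C := by
  have e : A.map σ = c.Di * c.Φ A * c.D := by
    rw [c.Φ_apply]
    calc A.map σ = (c.Di * c.D) * A.map σ * (c.Di * c.D) := by rw [c.Di_D]; simp
      _ = _ := by simp only [Matrix.mul_assoc]
  have e2 := congrFun (congrFun e i) j
  rw [Matrix.map_apply, D, Matrix.mul_diagonal, Di, Matrix.diagonal_mul] at e2
  rw [e2, abs_mul, abs_mul, abs_of_pos (by linarith [c.dc_ge j] : 0 < c.dc j),
    abs_of_pos (by have := c.dc_ge i; positivity)]
  have h1 := h i j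
  have h2 : (c.dc i)⁻¹ ≤ 1 := inv_le_one_of_one_le₀ (c.dc_ge i)
  have h3 : 0 < (c.dc i)⁻¹ := by have := c.dc_ge i; positivity
  have h4 := c.dc_le j
  have h5 := c.dc_ge j
  have h6 := abs_nonneg (c.Φ A i j)
  have h7 : (c.dc i)⁻¹ * |c.Φ A i j| ≤ C := by nlinarith
  have h8 : 0 ≤ (c.dc i)⁻¹ * |c.Φ A i j| := by positivity
  nlinarith

theorem σ'_form (A : Matrix ι ι R2) (h : Aᵀ * c.Q * A = c.Q) :
    (A.map σ')ᵀ * (c.Dᵀ * c.D) * A.map σ' = c.Dᵀ * c.D := by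
  have h1 := congrArg (fun X => X.map σ') h
  simp only [Matrix.map_mul, c.Q_σ', Matrix.transpose_map] at h1
  simpa using h1

theorem σ'_bound (A : Matrix ι ι R2) (h : Aᵀ * c.Q * A = c.Q) (i j : ι) : |σ' (A i j)| ≤ 2 := by
  have h1 := congrFun (congrFun (c.σ'_form A h) j) j
  rw [c.D_T, D, Matrix.diagonal_mul_diagonal, Matrix.diagonal_apply_eq, Matrix.mul_apply] at h1
  simp only [Matrix.mul_diagonal, Matrix.transpose_apply, Matrix.map_apply] at h1
  have h2 : σ' (A i j) * (c.dc i * c.dc i) * σ' (A i j) ≤ c.dc j * c.dc j := by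
    rw [← h1]
    refine Finset.single_le_sum (f := fun i => σ' (A i j) * (c.dc i * c.dc i) * σ' (A i j))
      (fun k _ => ?_) (Finset.mem_univ i)
    have := mul_self_nonneg (σ' (A k j) * c.dc k)
    linarith
  apply abs_le_of_sq_le_sq _ (by norm_num)
  have h3 := c.dc_ge i
  have h4 := c.dc_le j
  have h5 := c.dc_ge j
  have h6 : 1 ≤ c.dc i * c.dc i := by nlinarith
  nlinarith [sq_nonneg (σ' (A i j))]

theorem finite_Γ₀ (N : ℕ) (C : ℝ) :
    {A : (Matrix ι ι R2)ˣ | A ∈ c.Γ₀ N ∧ ∀ i j, |c.Φ A i j| ≤ C}.Finite := by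
  refine Set.Finite.of_finite_image (f := fun A : (Matrix ι ι R2)ˣ => (A : Matrix ι ι R2))
    ((finite_mat (max (2 * C) 2)).subset ?_) ?_
  · rintro _ ⟨A, ⟨hA, hC⟩, rfl⟩ i j
    exact ⟨(c.Φ_bound _ C hC i j).trans (le_max_left _ _),
      (c.σ'_bound _ hA.1 i j).trans (le_max_right _ _)⟩
  · intro A _ B _ h
    exact Units.ext h

theorem free (A : (Matrix ι ι R2)ˣ) (hA : A ∈ c.Γ₀ (2 * Fintype.card ι + 1)) (x : ι → ℝ)
    (hx : c.h x x = 1) (hfix : c.Φ A *ᵥ x = x) : A = 1 := by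
  obtain ⟨h1, h2, Z, hZ⟩ := hA
  obtain ⟨B, hB, hBdet⟩ := c.S_root x hx
  have hB0 : B.det ≠ 0 := by intro h; rw [h] at hBdet; simp at hBdet
  have e1 := c.S_equiv x (c.Φ A) (c.Φ_form _ h1) (c.Φ_J _ h2)
  rw [hfix, ← hB] at e1
  have t1 := (trace_lemma _ B hB0 e1).1
  rw [c.Φ_trace] at t1
  have hD0 : c.D.det ≠ 0 := by linarith [c.D_det_ge]
  obtain ⟨t2, t3⟩ := trace_lemma _ c.D hD0 (c.σ'_form _ h1)
  have t4 : ((A : Matrix ι ι R2).map σ').trace = σ' (A : Matrix ι ι R2).trace := by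
    simp [Matrix.trace, map_sum]
  rw [t4] at t2 t3
  have e2 : (A : Matrix ι ι R2).trace =
      (Fintype.card ι : R2) + ((2 * Fintype.card ι + 1 : ℕ) : R2) * Z.trace := by
    rw [hZ, Matrix.trace_add, Matrix.trace_one, Matrix.trace_smul, smul_eq_mul]
  have hm : (0 : ℝ) ≤ Fintype.card ι := by positivity
  have bnd : ∀ f : R2 →+* ℝ, |f (A : Matrix ι ι R2).trace| ≤ Fintype.card ι → |f Z.trace| < 1 := by
    intro f hf
    rw [e2, map_add, map_mul, map_natCast, map_natCast] at hf
    push_cast at hf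
    rw [abs_le] at hf
    rw [abs_lt]
    constructor <;> nlinarith [hf.1, hf.2]
  have b1 := bnd σ t1
  have b2 := bnd σ' t2
  have hz : Z.trace = 0 := by
    apply small_eq_zero
    nlinarith [abs_nonneg (σ Z.trace), abs_nonneg (σ' Z.trace)]
  rw [hz, mul_zero, add_zero] at e2
  have e3 := t3 (by rw [e2, map_natCast])
  apply Units.ext
  refine Matrix.ext fun i j => ?_
  apply_fun σ' using σ'_inj
  have := congrFun (congrFun e3 i) j
  rw [Matrix.map_apply] at this
  rw [this, Units.val_one, Matrix.one_apply, Matrix.one_apply]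
  split_ifs <;> simp

theorem sum_sq_trace (X : Matrix ι ι ℝ) : (Xᵀ * X).trace = ∑ j, ∑ i, X i j ^ 2 := by
  simp only [Matrix.trace, Matrix.diag_apply, Matrix.mul_apply, Matrix.transpose_apply, pow_two]

theorem proper_bound (g : Matrix ι ι ℝ) (hg : gᵀ * c.η * g = c.η)
    (hJ : g * c.J ℝ = c.J ℝ * g) (x : ι → ℝ) (hy : c.h (g *ᵥ x) (g *ᵥ x) = 1)
    (i j : ι) : g i j ^ 2 ≤ (c.S (g *ᵥ x)).trace * (c.S x).trace := by
  obtain ⟨B, hB, hBdet⟩ := c.S_root _ hy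
  have hB0 : B.det ≠ 0 := by intro h; rw [h] at hBdet; simp at hBdet
  have hu : IsUnit B.det := isUnit_iff_ne_zero.mpr hB0
  have e1 := c.S_equiv x g hg hJ
  have e2 : (B * g)ᵀ * (B * g) = c.S x := by
    rw [← e1, ← hB, Matrix.transpose_mul]; simp only [Matrix.mul_assoc]
  have e3 : B⁻¹ * (B⁻¹)ᵀ = c.η * c.S (g *ᵥ x) * c.η := by
    have k1 := c.S_inv _ hy
    have k2 : (c.η * c.S (g *ᵥ x) * c.η) * (Bᵀ * B) = 1 := by
      rw [hB, Matrix.mul_assoc, Matrix.mul_assoc, ← Matrix.mul_assoc (c.S _), k1, c.η_sq]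
    have k3 : (Bᵀ * B) * (B⁻¹ * (B⁻¹)ᵀ) = 1 := by
      rw [Matrix.mul_assoc, ← Matrix.mul_assoc B, Matrix.mul_nonsing_inv _ hu, Matrix.one_mul,
        ← Matrix.transpose_mul, Matrix.nonsing_inv_mul _ hu, Matrix.transpose_one]
    exact (left_inv_eq_right_inv k2 k3).symm
  have e4 : ((B⁻¹ᵀ)ᵀ * B⁻¹ᵀ).trace = (c.S (g *ᵥ x)).trace := by
    rw [Matrix.transpose_transpose, e3, Matrix.trace_mul_comm, ← Matrix.mul_assoc, c.η_sq,
      Matrix.one_mul]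
  have e5 : g = B⁻¹ * (B * g) := by
    rw [← Matrix.mul_assoc, Matrix.nonsing_inv_mul _ hu, Matrix.one_mul]
  rw [← e4, ← e2, sum_sq_trace, sum_sq_trace]
  conv_lhs => rw [e5, Matrix.mul_apply]
  refine (Finset.sum_mul_sq_le_sq_mul_sq _ _ _).trans ?_
  refine mul_le_mul ?_ ?_ (by positivity) (by positivity)
  · exact Finset.single_le_sum (f := fun i => ∑ k, (B⁻¹ᵀ) k i ^ 2) (fun _ _ => by positivity)
      (Finset.mem_univ i)
  · exact Finset.single_le_sum (f := fun j => ∑ k, (B * g) k j ^ 2) (fun _ _ => by positivity)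
      (Finset.mem_univ j)

end CD


namespace CD

set_option linter.unusedSectionVars false

variable {ι : Type} [Fintype ι] [DecidableEq ι] (c : CD ι)

theorem quad_root (B S : Matrix ι ι ℝ) (hB : Bᵀ * B = S) (v : ι → ℝ) :
    v ⬝ᵥ (S *ᵥ v) = ∑ i, (B *ᵥ v) i ^ 2 := by
  rw [← hB, ← Matrix.mulVec_mulVec, Matrix.dotProduct_mulVec, Matrix.vecMul_transpose]
  simp [dotProduct, pow_two]

/-- The matrix of the lattice in `ℝ^ι × ℝ^ι`. -/
noncomputable def latM (B : Matrix ι ι ℝ) : Matrix (ι ⊕ ι) (ι ⊕ ι) ℝ :=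
  Matrix.fromBlocks (B * c.D) (√2 • (B * c.D)) 1 (-√2 • 1)

/-- Assemble an integral vector. -/
def vec (x : ι ⊕ ι → ℤ) : ι → R2 := fun i => ⟨x (Sum.inl i), x (Sum.inr i)⟩

theorem latM_inl (B : Matrix ι ι ℝ) (x : ι ⊕ ι → ℤ) (i : ι) :
    (c.latM B *ᵥ (fun j => (x j : ℝ))) (Sum.inl i) = ((B * c.D) *ᵥ (fun j => σ (vec x j))) i := by
  rw [latM, Matrix.fromBlocks_mulVec]
  simp only [Sum.elim_inl]
  rw [Matrix.smul_mulVec, ← Matrix.mulVec_smul, ← Matrix.mulVec_add]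
  congr 2
  ext j
  simp [vec, σ_apply, Function.comp]
  ring

theorem latM_inr (B : Matrix ι ι ℝ) (x : ι ⊕ ι → ℤ) (i : ι) :
    (c.latM B *ᵥ (fun j => (x j : ℝ))) (Sum.inr i) = σ' (vec x i) := by
  rw [latM, Matrix.fromBlocks_mulVec]
  simp only [Sum.elim_inr]
  rw [Matrix.smul_mulVec, Matrix.one_mulVec, Matrix.one_mulVec]
  simp [vec, σ'_apply, Function.comp]
  ring

theorem latM_det (B : Matrix ι ι ℝ) :
    (c.latM B).det = B.det * c.D.det * (-(2 * √2)) ^ Fintype.card ι := by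
  have e : c.latM B = Matrix.fromBlocks (B * c.D) 0 0 1 *
      Matrix.fromBlocks 1 (√2 • 1) 1 (-√2 • 1) := by
    rw [Matrix.fromBlocks_multiply, latM]
    simp
  have e2 : (-√2 • (1 : Matrix ι ι ℝ)) - 1 * (√2 • 1) = (-(2 * √2)) • 1 := by
    rw [Matrix.one_mul, ← sub_smul]; congr 1; ring
  rw [e, Matrix.det_mul, Matrix.det_fromBlocks_zero₂₁, Matrix.det_one, Matrix.det_mul,
    Matrix.det_fromBlocks_one₁₁, e2, Matrix.det_smul, Matrix.det_one]
  ring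

theorem small_vec (δ : ℝ) (hδ : 0 < δ) (hδ2 : (Fintype.card ι : ℝ) * δ ^ 2 ≤ 1 / 4)
    (x : ι → ℝ) (hx : c.h x x = 1) (B : Matrix ι ι ℝ) (hB : Bᵀ * B = c.S x) (v : ι → R2)
    (h1 : ∀ i, |((B * c.D) *ᵥ (fun j => σ (v j))) i| < δ) (h2 : ∀ i, |σ' (v i)| < δ) : v = 0 := by
  set q : R2 := ∑ i, c.qc i * (v i * v i) with hq
  have sqb : ∀ y : ι → ℝ, (∀ i, |y i| < δ) → ∑ i, y i ^ 2 ≤ 1 / 4 := by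
    intro y hy
    refine le_trans ?_ hδ2
    calc ∑ i, y i ^ 2 ≤ ∑ _i : ι, δ ^ 2 := by
          apply Finset.sum_le_sum
          intro i _
          rw [← sq_abs]
          exact pow_le_pow_left₀ (abs_nonneg _) (hy i).le 2
      _ = _ := by simp
  have e1 : σ q = c.h (c.D *ᵥ (fun j => σ (v j))) (c.D *ᵥ (fun j => σ (v j))) := by
    simp only [hq, h, map_sum, map_mul, c.σ_qc, D, Matrix.mulVec_diagonal]
    apply Finset.sum_congr rfl; intros; ring
  have b1 : |σ q| ≤ 1 / 4 := by
    rw [e1]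
    refine (c.S_bound x _ hx).trans ?_
    rw [quad_root B _ hB, Matrix.mulVec_mulVec]
    exact sqb _ h1
  have e2 : σ' q = - ∑ i, (c.dc i * c.dc i) * σ' (v i) ^ 2 := by
    simp only [hq, map_sum, map_mul, c.σ'_qc, ← Finset.sum_neg_distrib]
    apply Finset.sum_congr rfl; intros; ring
  have b2 : |σ' q| ≤ 1 := by
    rw [e2, abs_neg, abs_of_nonneg (Finset.sum_nonneg fun i _ => by
      have := c.dc_ge i; positivity)]
    calc _ ≤ ∑ i, 4 * σ' (v i) ^ 2 := by
          apply Finset.sum_le_sum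
          intro i _
          apply mul_le_mul_of_nonneg_right _ (sq_nonneg _)
          nlinarith [c.dc_ge i, c.dc_le i]
      _ ≤ 1 := by rw [← Finset.mul_sum]; linarith [sqb _ h2]
  have hq0 : q = 0 := small_eq_zero q (by nlinarith [abs_nonneg (σ q), abs_nonneg (σ' q)])
  rw [hq0, map_zero] at e2
  have e3 : ∑ i, (c.dc i * c.dc i) * σ' (v i) ^ 2 = 0 := by linarith
  rw [Finset.sum_eq_zero_iff_of_nonneg (fun i _ => by have := c.dc_ge i; positivity)] at e3
  ext1 i
  have := e3 i (Finset.mem_univ i)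
  have hd := c.dc_ge i
  have h3 : σ' (v i) = 0 := by
    rcases mul_eq_zero.mp this with h | h
    · nlinarith
    · exact pow_eq_zero_iff two_ne_zero |>.mp h
  exact σ'_inj (by simpa using h3)

theorem reduced_vectors : ∃ R : ℝ, 0 < R ∧ ∀ x : ι → ℝ, c.h x x = 1 → ∀ B : Matrix ι ι ℝ,
    Bᵀ * B = c.S x → |B.det| = 1 → ∀ f : ι → ℝ, f ≠ 0 → ∃ v : ι → R2,
      (∀ i, |((B * c.D) *ᵥ (fun j => σ (v j))) i| ≤ R) ∧ (∀ i, |σ' (v i)| ≤ R) ∧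
      f ⬝ᵥ (fun i => σ' (v i)) ≠ 0 := by
  set m : ℝ := ((Fintype.card ι : ℕ) : ℝ) with hm
  have hm0 : 0 ≤ m := by positivity
  set δ : ℝ := 1 / (2 * (m + 1)) with hδ
  have hδ0 : 0 < δ := by positivity
  have hδ2 : m * δ ^ 2 ≤ 1 / 4 := by
    have : (m + 1) * δ = 1 / 2 := by rw [hδ]; field_simp
    nlinarith
  have hD := c.D_det_ge
  obtain ⟨R, hR0, hR⟩ := short_vectors (ι := ι ⊕ ι)
    (c.D.det * (2 * √2) ^ Fintype.card ι) δ (by positivity) hδ0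
  refine ⟨R, hR0, ?_⟩
  intro x hx B hB hBdet f hf
  have hdet : |(c.latM B).det| = c.D.det * (2 * √2) ^ Fintype.card ι := by
    rw [c.latM_det, abs_mul, abs_mul, hBdet, abs_pow, abs_neg,
      abs_of_pos (by linarith : 0 < c.D.det), abs_of_pos (by positivity : 0 < 2 * √2), one_mul]
  obtain ⟨z, hz1, hz2⟩ := hR (c.latM B) (by
      rw [← abs_pos, hdet]; positivity) hdet.le (by
      intro z hz
      by_contra hcon
      push Not at hcon
      apply hz
      have := c.small_vec δ hδ0 hδ2 x hx B hB (vec z)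
        (fun i => by rw [← c.latM_inl]; exact hcon _)
        (fun i => by rw [← c.latM_inr B]; exact hcon _)
      ext1 k
      rcases k with k | k
      · have := congrArg Zsqrtd.re (congrFun this k)
        simpa [vec] using this
      · have := congrArg Zsqrtd.im (congrFun this k)
        simpa [vec] using this) (Sum.elim 0 f) (by
      intro h0
      apply hf
      ext i
      have := congrFun h0 (Sum.inr i)
      simpa using this)
  refine ⟨vec z, ?_, ?_, ?_⟩
  · intro i; rw [← c.latM_inl]; exact hz1 _
  · intro i; rw [← c.latM_inr B]; exact hz1 _
  · convert hz2 using 1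
    simp only [dotProduct, Fintype.sum_sum_type, Sum.elim_inl, Sum.elim_inr, c.latM_inr]
    simp

/-- Vectors not contained in any hyperplane contain a basis. -/
theorem exists_matrix (T : Set (ι → ℝ)) (hT : ∀ f : ι → ℝ, f ≠ 0 → ∃ v ∈ T, f ⬝ᵥ v ≠ 0) :
    ∃ b : ι → (ι → ℝ), (∀ i, b i ∈ T) ∧ LinearIndependent ℝ b := by
  have hspan : Submodule.span ℝ T = ⊤ := by
    by_contra hne
    obtain ⟨φ, hφ, hker⟩ := Submodule.exists_le_ker_of_lt_top _ (lt_top_iff_ne_top.mpr hne)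
    obtain ⟨v, hv, hne⟩ := hT (fun i => φ (Pi.single i 1)) (by
      intro h0
      apply hφ
      refine LinearMap.pi_ext' fun i => ?_
      ext
      simpa using congrFun h0 i)
    apply hne
    have h1 : φ v = 0 := hker (Submodule.subset_span hv)
    rw [← h1, LinearMap.pi_apply_eq_sum_univ φ v, dotProduct]
    apply Finset.sum_congr rfl
    intro i _
    rw [smul_eq_mul, mul_comm]
    congr 2
    ext j
    simp [Pi.single_apply, eq_comm]
  obtain ⟨b, hbT, hbs, hbl⟩ := exists_linearIndependent ℝ T
  have hbas : ⊤ ≤ Submodule.span ℝ (Set.range ((↑) : b → ι → ℝ)) := by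
    rw [Subtype.range_coe, hbs, hspan]
  let bb := Module.Basis.mk hbl hbas
  let e := bb.indexEquiv (Pi.basisFun ℝ ι)
  refine ⟨fun i => (e.symm i : ι → ℝ), fun i => hbT (e.symm i).2, ?_⟩
  exact hbl.comp _ e.symm.injective

theorem reduced_matrix : ∃ R : ℝ, 0 < R ∧ ∀ x : ι → ℝ, c.h x x = 1 → ∀ B : Matrix ι ι ℝ,
    Bᵀ * B = c.S x → |B.det| = 1 → ∃ V : Matrix ι ι R2, V.det ≠ 0 ∧
      (∀ i j, |(B * c.D * V.map σ) i j| ≤ R) ∧ (∀ i j, |σ' (V i j)| ≤ R) := by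
  obtain ⟨R, hR0, hR⟩ := c.reduced_vectors
  refine ⟨R, hR0, ?_⟩
  intro x hx B hB hBdet
  obtain ⟨b, hbT, hbl⟩ := exists_matrix
    {w : ι → ℝ | ∃ v : ι → R2, (∀ i, |((B * c.D) *ᵥ (fun j => σ (v j))) i| ≤ R) ∧
      (∀ i, |σ' (v i)| ≤ R) ∧ (fun i => σ' (v i)) = w} (by
      intro f hf
      obtain ⟨v, h1, h2, h3⟩ := hR x hx B hB hBdet f hf
      exact ⟨_, ⟨v, h1, h2, rfl⟩, h3⟩)
  choose v h1 h2 h3 using hbT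
  refine ⟨Matrix.of fun i j => v j i, ?_, ?_, ?_⟩
  · intro h0
    have h4 := Matrix.linearIndependent_rows_iff_isUnit (A := Matrix.of b) |>.mp hbl
    rw [Matrix.isUnit_iff_isUnit_det, isUnit_iff_ne_zero] at h4
    apply h4
    have h5 : Matrix.of b = ((Matrix.of fun i j => v j i : Matrix ι ι R2).map σ')ᵀ := by
      ext i j
      simp [← h3]
    rw [h5, Matrix.det_transpose]
    have := RingHom.map_det σ' (Matrix.of fun i j => v j i : Matrix ι ι R2)
    rw [RingHom.mapMatrix_apply] at this
    rw [← this, h0, map_zero]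
  · intro i j
    exact h1 j i
  · intro i j
    exact h2 j i

end CD


instance : IsDomain R2 := σ_inj.isDomain

namespace CD

set_option linter.unusedSectionVars false

variable {ι : Type} [Fintype ι] [DecidableEq ι] (c : CD ι)

theorem cancel_left (U X Y : Matrix ι ι R2) (hU : U.det ≠ 0) (h : U * X = U * Y) : X = Y := by
  have h1 := congrArg (fun Z => U.adjugate * Z) h
  simp only [← Matrix.mul_assoc, Matrix.adjugate_mul, Matrix.smul_mul, Matrix.one_mul] at h1
  ext1 i j
  have := congrFun (congrFun h1 i) j
  simp only [Matrix.smul_apply, smul_eq_mul] at this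
  exact mul_left_cancel₀ hU this

theorem cancel_both (W X Y : Matrix ι ι R2) (hW : W.det ≠ 0) (h : Wᵀ * X * W = Wᵀ * Y * W) :
    X = Y := by
  rw [Matrix.mul_assoc, Matrix.mul_assoc] at h
  have h1 := cancel_left Wᵀ _ _ (by rwa [Matrix.det_transpose]) h
  have h2 := congrArg Matrix.transpose h1
  rw [Matrix.transpose_mul, Matrix.transpose_mul] at h2
  exact Matrix.transpose_injective (cancel_left Wᵀ _ _ (by rwa [Matrix.det_transpose]) h2)

theorem Q_det : c.Q.det ≠ 0 := by
  rw [Q, Matrix.det_diagonal, Finset.prod_ne_zero_iff]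
  intro i _ h
  have := c.σ'_qc i
  rw [h, map_zero] at this
  nlinarith [c.dc_ge i]

theorem gram_apply (V W : Matrix ι ι R2) (i j : ι) :
    (Vᵀ * c.Q * W) i j = ∑ k, V k i * c.qc k * W k j := by
  rw [Matrix.mul_apply]
  simp [Q, Matrix.mul_diagonal]

theorem gram_σ' (V W : Matrix ι ι R2) (R : ℝ) (hR : 0 < R) (hV : ∀ i j, |σ' (V i j)| ≤ R)
    (hW : ∀ i j, |σ' (W i j)| ≤ R) (i j : ι) :
    |σ' ((Vᵀ * c.Q * W) i j)| ≤ 4 * (Fintype.card ι * R ^ 2) := by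
  rw [c.gram_apply, map_sum]
  refine (Finset.abs_sum_le_sum_abs _ _).trans ?_
  calc _ ≤ ∑ _k : ι, 4 * R ^ 2 := by
        apply Finset.sum_le_sum
        intro k _
        rw [map_mul, map_mul, c.σ'_qc, abs_mul, abs_mul, abs_neg]
        have h1 : |c.dc k * c.dc k| ≤ 4 := by
          rw [abs_of_nonneg (mul_self_nonneg _)]; nlinarith [c.dc_ge k, c.dc_le k]
        calc _ ≤ R * 4 * R := by
              gcongr
              · exact hV _ _
              · exact hW _ _
          _ = _ := by ring
    _ = _ := by simp; ring

/-- Columns of the rescaled real matrix. -/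
noncomputable def col (V : Matrix ι ι R2) (j : ι) : ι → ℝ := c.D *ᵥ (fun k => σ (V k j))

theorem gram_σ (x : ι → ℝ) (hx : c.h x x = 1) (V W : Matrix ι ι R2) (M : ℝ)
    (hV : ∀ j, c.col V j ⬝ᵥ (c.S x *ᵥ c.col V j) ≤ M)
    (hW : ∀ j, c.col W j ⬝ᵥ (c.S x *ᵥ c.col W j) ≤ M) (i j : ι) :
    |σ ((Vᵀ * c.Q * W) i j)| ≤ 4 * M := by
  have e : σ ((Vᵀ * c.Q * W) i j) = c.h (c.col V i) (c.col W j) := by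
    rw [c.gram_apply, map_sum, h]
    apply Finset.sum_congr rfl
    intro k _
    rw [map_mul, map_mul, c.σ_qc, col, col, D, Matrix.mulVec_diagonal, Matrix.mulVec_diagonal]
    ring
  rw [e]
  have := c.S_bound2 x (c.col V i) (c.col W j) hx
  linarith [hV i, hW j]

theorem col_J (V : Matrix ι ι R2) (j : ι) : c.col (c.J R2 * V) j = c.J ℝ *ᵥ c.col V j := by
  rw [col, col, Matrix.mulVec_mulVec, ← c.D_J, ← Matrix.mulVec_mulVec]
  congr 1
  ext k
  rw [c.J_mulVec]
  have : (c.J R2 * V) k j = c.s k * V (c.τ k) j := c.J_mulVec (fun k => V k j) k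
  rw [this, map_mul, map_intCast]

theorem J_bound (V : Matrix ι ι R2) (R : ℝ) (hV : ∀ i j, |σ' (V i j)| ≤ R) (i j : ι) :
    |σ' ((c.J R2 * V) i j)| ≤ R := by
  have : (c.J R2 * V) i j = c.s i * V (c.τ i) j := c.J_mulVec (fun k => V k j) i
  rw [this, map_mul, map_intCast, abs_mul]
  have h1 : |(c.s i : ℝ)| = 1 := by
    have h2 : (c.s i : ℝ) * c.s i = 1 := by exact_mod_cast c.hs i
    rw [← sq_eq_sq₀ (abs_nonneg _) (by norm_num), sq_abs]; linarith
  rw [h1, one_mul]; exact hV _ _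

/-- The algebraic step of the pigeonhole argument. -/
theorem make_elt (N K : ℕ) (V W : Matrix ι ι R2) (hW : W.det ≠ 0)
    (hK : (W.det.norm).natAbs ∣ K)
    (hG : Vᵀ * c.Q * V = Wᵀ * c.Q * W)
    (hG2 : Vᵀ * c.Q * (c.J R2 * V) = Wᵀ * c.Q * (c.J R2 * W))
    (Z : Matrix ι ι R2) (hZ : V = W + ((N * K : ℕ) : R2) • Z) :
    ∃ A ∈ c.Γ₀ N, (A : Matrix ι ι R2) * W = V := by
  obtain ⟨e, he⟩ : ∃ e : R2, (K : R2) = e * W.det := by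
    have h1 : W.det.norm ∣ (K : ℤ) := Int.natAbs_dvd.mp (by exact_mod_cast hK)
    obtain ⟨t, ht⟩ := h1
    refine ⟨star W.det * t, ?_⟩
    have h2 : (K : R2) = ((K : ℤ) : R2) := by simp
    rw [h2, ht, Int.cast_mul, Zsqrtd.norm_eq_mul_conj]; ring
  set A : Matrix ι ι R2 := 1 + (N : R2) • (Z * (e • W.adjugate)) with hA
  have hAW : A * W = V := by
    rw [hA, hZ, Matrix.add_mul, Matrix.one_mul, Matrix.smul_mul, Matrix.mul_assoc, Matrix.smul_mul,
      Matrix.adjugate_mul, smul_smul, ← he, Matrix.mul_smul, Matrix.mul_one, smul_smul]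
    push_cast; rfl
  have q1 : Aᵀ * c.Q * A = c.Q := by
    apply cancel_both W _ _ hW
    rw [← hG, ← hAW, Matrix.transpose_mul]
    simp only [Matrix.mul_assoc]
  have q2 : Aᵀ * c.Q * (c.J R2 * A) = c.Q * c.J R2 := by
    apply cancel_both W _ _ hW
    have : Wᵀ * (c.Q * c.J R2) * W = Wᵀ * c.Q * (c.J R2 * W) := by
      simp only [Matrix.mul_assoc]
    rw [this, ← hG2, ← hAW, Matrix.transpose_mul]
    simp only [Matrix.mul_assoc]
  have hdet : A.det * A.det = 1 := by
    have := congrArg Matrix.det q1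
    rw [Matrix.det_mul, Matrix.det_mul, Matrix.det_transpose] at this
    apply mul_right_cancel₀ c.Q_det
    linear_combination this
  have hA0 : A.det ≠ 0 := by intro h0; rw [h0] at hdet; simp at hdet
  have q3 : A * c.J R2 = c.J R2 * A := by
    apply cancel_left (Aᵀ * c.Q)
    · rw [Matrix.det_mul, Matrix.det_transpose]; exact mul_ne_zero hA0 c.Q_det
    · rw [q2, ← Matrix.mul_assoc, q1]
  have hu : IsUnit A := by
    rw [Matrix.isUnit_iff_isUnit_det]
    exact IsUnit.of_mul_eq_one _ hdet
  obtain ⟨u, hu⟩ := hu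
  refine ⟨u, ⟨?_, ?_, _, hu.trans hA⟩, ?_⟩
  · rw [hu, q1]
  · rw [hu, q3]
  · rw [hu, hAW]

theorem h_pres (g : Matrix ι ι ℝ) (hg : gᵀ * c.η * g = c.η) (x : ι → ℝ) :
    c.h (g *ᵥ x) (g *ᵥ x) = c.h x x := by
  rw [c.h_eq, c.h_eq]
  conv_rhs => rw [← hg]
  rw [← Matrix.mulVec_mulVec, ← Matrix.mulVec_mulVec, Matrix.dotProduct_mulVec x gᵀ,
    Matrix.vecMul_transpose]

theorem norm_bound (B : Matrix ι ι ℝ) (hB : |B.det| = 1) (V : Matrix ι ι R2) (R : ℝ)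
    (h1 : ∀ i j, |(B * c.D * V.map σ) i j| ≤ R) (h2 : ∀ i j, |σ' (V i j)| ≤ R) :
    |(V.det.norm : ℝ)| ≤ ((Fintype.card ι).factorial * R ^ Fintype.card ι) ^ 2 := by
  have b1 : |(B * c.D * V.map σ).det| ≤ (Fintype.card ι).factorial * R ^ Fintype.card ι := by
    have := Matrix.det_le (abv := AbsoluteValue.abs) (A := B * c.D * V.map σ) (x := R)
      (fun i j => h1 i j)
    simpa [nsmul_eq_mul] using this
  have b2 : |(V.map σ').det| ≤ (Fintype.card ι).factorial * R ^ Fintype.card ι := by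
    have := Matrix.det_le (abv := AbsoluteValue.abs) (A := V.map σ') (x := R)
      (fun i j => h2 i j)
    simpa [nsmul_eq_mul] using this
  have e1 : σ V.det = (V.map σ).det := RingHom.map_det σ V
  have e2 : σ' V.det = (V.map σ').det := RingHom.map_det σ' V
  have b3 : |(V.map σ).det| ≤ (Fintype.card ι).factorial * R ^ Fintype.card ι := by
    refine le_trans ?_ b1
    have hD := c.D_det_ge
    rw [Matrix.det_mul, Matrix.det_mul, abs_mul, abs_mul, hB, one_mul, 
      abs_of_pos (by linarith : 0 < c.D.det)]
    exact le_mul_of_one_le_left (abs_nonneg _) hD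
  rw [← σ_norm, abs_mul, e1, e2, pow_two]
  exact mul_le_mul b3 b2 (abs_nonneg _) ((abs_nonneg _).trans b3)

theorem cocompact (N : ℕ) (hN : 0 < N) : ∃ C : ℝ, ∀ x : ι → ℝ, c.h x x = 1 →
    ∃ A ∈ c.Γ₀ N, ∃ y : ι → ℝ, c.h y y = 1 ∧ ∑ i, y i ^ 2 ≤ C ∧
      c.Φ (A : Matrix ι ι R2) *ᵥ y = x := by
  classical
  obtain ⟨R, hR0, hR⟩ := c.reduced_matrix
  have hex : ∀ x : {x : ι → ℝ // c.h x x = 1}, ∃ B : Matrix ι ι ℝ, ∃ V : Matrix ι ι R2,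
      Bᵀ * B = c.S x.1 ∧ |B.det| = 1 ∧ V.det ≠ 0 ∧
      (∀ i j, |(B * c.D * V.map σ) i j| ≤ R) ∧ (∀ i j, |σ' (V i j)| ≤ R) := by
    rintro ⟨x, hx⟩
    obtain ⟨B, hB, hd⟩ := c.S_root x hx
    obtain ⟨V, hV⟩ := hR x hx B hB hd
    exact ⟨B, V, hB, hd, hV⟩
  choose B V hB hBd hV0 hV1 hV2 using hex
  obtain ⟨K, hK0, hK⟩ : ∃ K : ℕ, 0 < K ∧ ∀ x, ((V x).det.norm).natAbs ∣ K := by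
    let k : ℕ := ⌈((Fintype.card ι).factorial * R ^ Fintype.card ι) ^ 2⌉₊
    refine ⟨k.factorial, Nat.factorial_pos _, fun x => Nat.dvd_factorial ?_ ?_⟩
    · rw [Int.natAbs_pos]
      rw [Ne, Zsqrtd.norm_eq_zero two_nonsq]
      exact hV0 x
    · have h1 := (c.norm_bound (B x) (hBd x) (V x) R (hV1 x) (hV2 x)).trans (Nat.le_ceil _)
      have h2 : |(V x).det.norm| ≤ (k : ℤ) := by exact_mod_cast h1
      rw [Int.abs_eq_natAbs] at h2
      exact_mod_cast h2
  set P : ℕ := N * K with hP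
  have : NeZero P := ⟨by positivity⟩
  let F : {x : ι → ℝ // c.h x x = 1} →
      Matrix ι ι R2 × Matrix ι ι R2 × (ι → ι → ZMod P × ZMod P) := fun x =>
    ((V x)ᵀ * c.Q * V x, (V x)ᵀ * c.Q * (c.J R2 * V x),
      fun i j => (((V x i j).re : ZMod P), ((V x i j).im : ZMod P)))
  have hFfin : (Set.range F).Finite := by
    have hf := finite_mat (ι := ι) (4 * (Fintype.card ι * R ^ 2))
    refine (hf.prod (hf.prod (Set.finite_univ
      (α := ι → ι → ZMod P × ZMod P)))).subset ?_
    rintro _ ⟨x, rfl⟩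
    have hcol : ∀ j, c.col (V x) j ⬝ᵥ (c.S x.1 *ᵥ c.col (V x) j) ≤ Fintype.card ι * R ^ 2 := by
      intro j
      rw [quad_root (B x) _ (hB x), col, Matrix.mulVec_mulVec]
      calc _ ≤ ∑ _i : ι, R ^ 2 := by
            apply Finset.sum_le_sum
            intro i _
            rw [← sq_abs]
            exact pow_le_pow_left₀ (abs_nonneg _) (hV1 x i j) 2
        _ = _ := by simp
    have hcolJ : ∀ j, c.col (c.J R2 * V x) j ⬝ᵥ (c.S x.1 *ᵥ c.col (c.J R2 * V x) j)
        ≤ Fintype.card ι * R ^ 2 := by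
      intro j
      rw [c.col_J, c.S_quad_J]; exact hcol j
    refine ⟨?_, ?_, Set.mem_univ _⟩
    · intro i j
      exact ⟨c.gram_σ x.1 x.2 _ _ _ hcol hcol i j, c.gram_σ' _ _ R hR0 (hV2 x) (hV2 x) i j⟩
    · intro i j
      exact ⟨c.gram_σ x.1 x.2 _ _ _ hcol hcolJ i j,
        c.gram_σ' _ _ R hR0 (hV2 x) (c.J_bound _ R (hV2 x)) i j⟩
  have : Finite (Set.range F) := hFfin
  let cst : Matrix ι ι R2 → ℝ := fun W =>
    ∑ j, ∑ _i : ι, (∑ k, R * |((c.D * W.map σ)⁻¹) k j|) ^ 2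
  obtain ⟨M, hM⟩ := (Set.finite_range (fun a : Set.range F => cst (V (Set.rangeSplitting F a)))).bddAbove
  refine ⟨(M + ∑ i, (c.ε i : ℝ)) / 4, ?_⟩
  intro x₀ hx₀
  set x : {x : ι → ℝ // c.h x x = 1} := ⟨x₀, hx₀⟩ with hx
  set w := Set.rangeSplitting F ⟨F x, x, rfl⟩ with hw
  have hFw : F w = F x := Set.apply_rangeSplitting F ⟨F x, x, rfl⟩
  have hMw : cst (V w) ≤ M := hM ⟨_, rfl⟩
  simp only [F, Prod.mk.injEq] at hFw
  obtain ⟨f1, f2, f3⟩ := hFw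
  have hdiv : ∀ i j, ∃ z : R2, V x i j = V w i j + (P : R2) * z := by
    intro i j
    have f4 := congrFun (congrFun f3 i) j
    simp only [Prod.mk.injEq] at f4
    obtain ⟨f5, f6⟩ := f4
    rw [ZMod.intCast_eq_intCast_iff_dvd_sub] at f5 f6
    obtain ⟨a, ha⟩ := f5
    obtain ⟨b, hb⟩ := f6
    refine ⟨⟨a, b⟩, ?_⟩
    ext
    · simp; linarith
    · simp; linarith
  choose Z hZ using hdiv
  obtain ⟨A, hA, hAW⟩ := c.make_elt N K (V x) (V w) (hV0 w) (hK w) f1.symm f2.symm (Matrix.of Z)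
    (by ext1 i j; simpa [hP] using hZ i j)
  have hA' := (c.Γ₀ N).inv_mem hA
  have hΦ : c.Φ (A : Matrix ι ι R2) * c.Φ ((A⁻¹ : (Matrix ι ι R2)ˣ) : Matrix ι ι R2) = 1 := by
    rw [← map_mul, A.mul_inv, map_one]
  set g := c.Φ (A : Matrix ι ι R2) with hg
  set y := c.Φ ((A⁻¹ : (Matrix ι ι R2)ˣ) : Matrix ι ι R2) *ᵥ x₀ with hy
  have hgy : g *ᵥ y = x₀ := by
    rw [hy, Matrix.mulVec_mulVec, hΦ, Matrix.one_mulVec]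
  refine ⟨A, hA, y, ?_, ?_, hgy⟩
  · rw [hy, c.h_pres _ (c.Φ_form _ hA'.1), hx₀]
  · have e1 := c.S_equiv y g (c.Φ_form _ hA.1) (c.Φ_J _ hA.2.1)
    have hBx : (B x)ᵀ * B x = c.S x₀ := hB x
    rw [hgy, ← hBx] at e1
    have e2 : (B x * g)ᵀ * (B x * g) = c.S y := by
      rw [← e1, Matrix.transpose_mul]; simp only [Matrix.mul_assoc]
    have e3 := congrArg Matrix.trace e2
    rw [sum_sq_trace, c.S_trace] at e3
    have hu : IsUnit (c.D * (V w).map σ).det := by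
      rw [isUnit_iff_ne_zero, Matrix.det_mul]
      refine mul_ne_zero (by linarith [c.D_det_ge]) ?_
      have : σ (V w).det = ((V w).map σ).det := RingHom.map_det σ (V w)
      rw [← this]
      exact fun h0 => hV0 w (σ_inj (by simpa using h0))
    have e4 : B x * g = (B x * c.D * (V x).map σ) * (c.D * (V w).map σ)⁻¹ := by
      have e5 : (B x * g) * (c.D * (V w).map σ) = B x * c.D * (V x).map σ := by
        rw [← hAW, Matrix.map_mul, hg, c.Φ_apply]
        calc _ = B x * c.D * (A : Matrix ι ι R2).map σ * (c.Di * c.D) * (V w).map σ := by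
              simp only [Matrix.mul_assoc]
          _ = _ := by rw [c.Di_D]; simp only [Matrix.mul_assoc, Matrix.one_mul]
      rw [← e5, Matrix.mul_assoc, Matrix.mul_nonsing_inv _ hu, Matrix.mul_one]
    have e6 : ∑ j, ∑ i, (B x * g) i j ^ 2 ≤ cst (V w) := by
      apply Finset.sum_le_sum; intro j _
      apply Finset.sum_le_sum; intro i _
      rw [← sq_abs]
      refine pow_le_pow_left₀ (abs_nonneg _) ?_ 2
      rw [e4, Matrix.mul_apply]
      refine (Finset.abs_sum_le_sum_abs _ _).trans ?_
      apply Finset.sum_le_sum; intro k _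
      rw [abs_mul]
      exact mul_le_mul_of_nonneg_right (hV1 x i k) (abs_nonneg _)
    linarith

end CD


namespace CD

set_option linter.unusedSectionVars false

variable {ι : Type} [Fintype ι] [DecidableEq ι] (c : CD ι)

/-- The lattice inside the real group. -/
noncomputable def G : Subgroup (Matrix ι ι ℝ)ˣ :=
  (c.Γ₀ (2 * Fintype.card ι + 1)).map (Units.map c.Φ)

theorem G_form (γ : (Matrix ι ι ℝ)ˣ) (hγ : γ ∈ c.G) :
    (γ : Matrix ι ι ℝ)ᵀ * c.η * γ = c.η := by
  obtain ⟨A, hA, rfl⟩ := hγ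
  exact c.Φ_form _ hA.1

theorem G_J (γ : (Matrix ι ι ℝ)ˣ) (hγ : γ ∈ c.G) :
    (γ : Matrix ι ι ℝ) * c.J ℝ = c.J ℝ * γ := by
  obtain ⟨A, hA, rfl⟩ := hγ
  exact c.Φ_J _ hA.2.1

theorem G_finite (C : ℝ) :
    {γ : c.G | ∀ i j, |((γ : (Matrix ι ι ℝ)ˣ) : Matrix ι ι ℝ) i j| ≤ C}.Finite := by
  refine Set.Finite.of_finite_image (f := fun γ : c.G => (γ : (Matrix ι ι ℝ)ˣ)) ?_
    Subtype.val_injective.injOn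
  refine ((c.finite_Γ₀ (2 * Fintype.card ι + 1) C).image (Units.map c.Φ)).subset ?_
  rintro _ ⟨⟨_, A, hA, rfl⟩, h, rfl⟩
  exact ⟨A, ⟨hA, h⟩, rfl⟩

theorem G_free (γ : c.G) (x : ι → ℝ) (hx : c.h x x = 1)
    (h : ((γ : (Matrix ι ι ℝ)ˣ) : Matrix ι ι ℝ) *ᵥ x = x) : γ = 1 := by
  obtain ⟨_, A, hA, rfl⟩ := γ
  have := c.free A hA x hx h
  subst this
  ext1
  simp

theorem trace_nonneg (x : ι → ℝ) (hx : c.h x x = 1) : 0 ≤ (c.S x).trace := by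
  obtain ⟨B, hB, -⟩ := c.S_root x hx
  rw [← hB, sum_sq_trace]; positivity

theorem bdd_trace (K : Set (ι → ℝ)) (hK : IsCompact K) :
    ∃ M : ℝ, 0 ≤ M ∧ ∀ x ∈ K, (c.S x).trace ≤ M := by
  have hc : Continuous (fun x : ι → ℝ => 4 * ∑ i, x i ^ 2 - ∑ i, (c.ε i : ℝ)) := by fun_prop
  obtain ⟨M, hM⟩ := (hK.image hc).bddAbove
  refine ⟨max M 0, le_max_right _ _, fun x hx => ?_⟩
  rw [c.S_trace]
  exact (hM ⟨x, hx, rfl⟩).trans (le_max_left _ _)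

theorem G_proper (K L : Set (ι → ℝ)) (hK : ∀ x ∈ K, c.h x x = 1) (hL : ∀ x ∈ L, c.h x x = 1)
    (cK : IsCompact K) (cL : IsCompact L) :
    {γ : c.G | ∃ x ∈ K, ((γ : (Matrix ι ι ℝ)ˣ) : Matrix ι ι ℝ) *ᵥ x ∈ L}.Finite := by
  obtain ⟨M, hM0, hM⟩ := c.bdd_trace K cK
  obtain ⟨M', hM0', hM'⟩ := c.bdd_trace L cL
  refine (c.G_finite (M' * M + 1)).subset ?_
  rintro γ ⟨x, hx, hy⟩ i j
  have h1 := c.proper_bound _ (c.G_form _ γ.2) (c.G_J _ γ.2) x (hL _ hy) i j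
  have h2 := mul_le_mul (hM' _ hy) (hM _ hx) (c.trace_nonneg x (hK x hx)) hM0'
  apply abs_le_of_sq_le_sq _ (by positivity)
  nlinarith [mul_nonneg hM0' hM0]

theorem G_discrete : DiscreteTopology c.G := by
  apply discreteTopology_of_isOpen_singleton_one
  have hcont : ∀ i j, Continuous
      (fun γ : c.G => ((γ : (Matrix ι ι ℝ)ˣ) : Matrix ι ι ℝ) i j) := fun i j =>
    (Units.continuous_val.comp continuous_subtype_val).matrix_elem i j
  let U : Set c.G := {γ | ∀ i j, |((γ : (Matrix ι ι ℝ)ˣ) : Matrix ι ι ℝ) i j| < 2}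
  have hU : IsOpen U := by
    have : U = ⋂ i, ⋂ j, {γ : c.G | |((γ : (Matrix ι ι ℝ)ˣ) : Matrix ι ι ℝ) i j| < 2} := by
      ext; simp [U]
    rw [this]
    exact isOpen_iInter_of_finite fun i => isOpen_iInter_of_finite fun j =>
      isOpen_lt (hcont i j).abs continuous_const
  have hUf : U.Finite := (c.G_finite 2).subset fun γ hγ i j => (hγ i j).le
  have hF : IsClosed (U \ {1}) := (hUf.subset Set.diff_subset).isClosed
  have : ({1} : Set c.G) = U \ (U \ {1}) := by
    rw [Set.diff_diff_cancel_left]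
    rintro _ rfl i j
    by_cases h : i = j <;> simp [h, Matrix.one_apply]
  rw [this]
  exact hU.sdiff hF

theorem G_cocompact : ∃ K : Set (ι → ℝ), (∀ x ∈ K, c.h x x = 1) ∧ IsCompact K ∧
    ∀ x, c.h x x = 1 → ∃ γ ∈ c.G, ∃ y ∈ K, (γ : Matrix ι ι ℝ) *ᵥ y = x := by
  obtain ⟨C, hC⟩ := c.cocompact (2 * Fintype.card ι + 1) (by omega)
  have h1 : Continuous (fun x : ι → ℝ => c.h x x) := by unfold h; fun_prop
  have h2 : Continuous (fun x : ι → ℝ => ∑ i, x i ^ 2) := by fun_prop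
  refine ⟨{x | c.h x x = 1 ∧ ∑ i, x i ^ 2 ≤ C}, fun x hx => hx.1, ?_, ?_⟩
  · apply Metric.isCompact_of_isClosed_isBounded
    · exact (isClosed_eq h1 continuous_const).inter (isClosed_le h2 continuous_const)
    · refine (Metric.isBounded_closedBall (x := (0 : ι → ℝ)) (r := |C| + 1)).subset ?_
      rintro x ⟨-, hx⟩
      rw [mem_closedBall_zero_iff, pi_norm_le_iff_of_nonneg (by positivity)]
      intro i
      have := Finset.single_le_sum (f := fun i => x i ^ 2) (fun _ _ => sq_nonneg _)
        (Finset.mem_univ i)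
      rw [Real.norm_eq_abs]
      apply abs_le_of_sq_le_sq _ (by positivity)
      nlinarith [le_abs_self C, abs_nonneg C]
  · intro x hx
    obtain ⟨A, hA, y, hy, hyC, hyx⟩ := hC x hx
    exact ⟨_, ⟨A, hA, rfl⟩, y, ⟨hy, hyC⟩, hyx⟩

theorem G_infinite (q : ι) (hq : q ≠ c.p) (hq2 : q ≠ c.τ c.p) :
    (c.G : Set (Matrix ι ι ℝ)ˣ).Infinite := by
  intro hfin
  obtain ⟨K, -, hKc, hK⟩ := c.G_cocompact
  have hcomp : IsCompact (⋃ γ ∈ (c.G : Set (Matrix ι ι ℝ)ˣ),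
      (fun y => (γ : Matrix ι ι ℝ) *ᵥ y) '' K) :=
    hfin.isCompact_biUnion fun γ _ => hKc.image (by fun_prop)
  obtain ⟨M, hM⟩ := (hcomp.image (continuous_apply q)).bddAbove
  let t : ℝ := |M| + 1
  let x : ι → ℝ := fun i => if i = c.p then Real.sqrt (1 + t ^ 2) else if i = q then t else 0
  have hx : c.h x x = 1 := by
    have e : ∀ i, (c.ε i : ℝ) * x i * x i =
        (if i = c.p then 1 + t ^ 2 else 0) + (if i = q then - t ^ 2 else 0) := by
      intro i
      rw [c.hε]
      by_cases h1 : i = c.p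
      · have : i ≠ q := fun h => hq (h ▸ h1)
        have h3 := Real.mul_self_sqrt (show 0 ≤ 1 + t ^ 2 by positivity)
        simp [x, h1, hq.symm, h3]
      · by_cases h2 : i = q
        · subst h2
          simp [x, hq, hq2]; ring
        · simp [x, h1, h2]
    rw [h, Finset.sum_congr rfl (fun i _ => e i), Finset.sum_add_distrib]
    simp
  obtain ⟨γ, hγ, y, hy, hyx⟩ := hK x hx
  have := hM ⟨x, Set.mem_biUnion hγ ⟨y, hy, hyx⟩, rfl⟩
  simp only [x, if_neg hq, if_true, t] at this
  linarith [le_abs_self M]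

end CD

/-- The concrete combinatorial data on `Fin (2 + 2 * n)`. -/
def cd (n : ℕ) : CD (Fin (2 + 2 * n)) where
  τ i := if h : (i : ℕ) % 2 = 0 then ⟨i + 1, by omega⟩ else ⟨i - 1, by omega⟩
  hτ i := by
    ext
    by_cases h : (i : ℕ) % 2 = 0
    · have : ¬ ((i : ℕ) + 1) % 2 = 0 := by omega
      simp [h, this]
    · have : ((i : ℕ) - 1) % 2 = 0 := by omega
      simp [h, this]
      omega
  s i := if (i : ℕ) % 2 = 0 then 1 else -1
  hs i := by split_ifs <;> simp
  hsτ i := by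
    by_cases h : (i : ℕ) % 2 = 0
    · have : ¬ ((i : ℕ) + 1) % 2 = 0 := by omega
      simp [h, this]
    · have : ((i : ℕ) - 1) % 2 = 0 := by omega
      simp [h, this]
  p := ⟨0, by omega⟩
  ε i := if (i : ℕ) < 2 then 1 else -1
  hε i := by
    have : ((i : ℕ) < 2) ↔ ((i : ℕ) = 0 ∨ (i : ℕ) = 1) := by omega
    simp only [Fin.ext_iff, this, dif_pos, Nat.zero_mod, Nat.zero_add]

theorem cd_η (n : ℕ) : (cd n).η = pseudoForm 2 (2 * n) := by
  rw [CD.η, pseudoForm]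
  congr 1
  ext i
  simp only [cd]
  split_ifs <;> simp

theorem cd_h (n : ℕ) (x : Fin (2 + 2 * n) → ℝ) :
    x ∈ pseudoSphere 2 (2 * n) ↔ (cd n).h x x = 1 := by
  change (∑ i : Fin (2 + 2 * n), (if (i : ℕ) < 2 then (1 : ℝ) else -1) * x i ^ 2 = 1) ↔ _
  rw [CD.h]
  have : ∀ i : Fin (2 + 2 * n), (if (i : ℕ) < 2 then (1 : ℝ) else -1) * x i ^ 2 =
      ((cd n).ε i : ℝ) * x i * x i := by
    intro i
    simp only [cd]
    split_ifs <;> simp <;> ring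
  rw [Finset.sum_congr rfl (fun i _ => this i)]

end AdSForm

/-- **Kulkarni: existence of compact anti-de Sitter space forms.**  For every `n ≥ 1` there
is an infinite discrete subgroup `Γ` of `O(2, 2n)` acting freely, properly discontinuously
and cocompactly on the quadric `{x ∈ ℝ^{2n+2} : x₁² + x₂² − x₃² − ⋯ − x_{2n+2}² = 1}`;
equivalently, `AdS^{2n+1}` admits a compact Clifford–Klein form. -/
theorem compact_antiDeSitter_space_forms_exist (n : ℕ) (hn : 1 ≤ n) :
    ∃ Γ : Subgroup (Matrix.GeneralLinearGroup (Fin (2 + 2 * n)) ℝ),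
      (∀ γ ∈ Γ, (γ : Matrix (Fin (2 + 2 * n)) (Fin (2 + 2 * n)) ℝ)ᵀ *
        pseudoForm 2 (2 * n) * γ = pseudoForm 2 (2 * n)) ∧
      (Γ : Set (Matrix.GeneralLinearGroup (Fin (2 + 2 * n)) ℝ)).Infinite ∧
      DiscreteTopology Γ ∧
      (∀ γ : Γ, (∃ x ∈ pseudoSphere 2 (2 * n),
          ((γ : Matrix.GeneralLinearGroup (Fin (2 + 2 * n)) ℝ) :
              Matrix (Fin (2 + 2 * n)) (Fin (2 + 2 * n)) ℝ).mulVec x = x) → γ = 1) ∧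
      (∀ K L : Set (Fin (2 + 2 * n) → ℝ),
        K ⊆ pseudoSphere 2 (2 * n) → L ⊆ pseudoSphere 2 (2 * n) →
        IsCompact K → IsCompact L →
        {γ : Γ | ∃ x ∈ K,
          ((γ : Matrix.GeneralLinearGroup (Fin (2 + 2 * n)) ℝ) :
              Matrix (Fin (2 + 2 * n)) (Fin (2 + 2 * n)) ℝ).mulVec x ∈ L}.Finite) ∧
      (∃ K : Set (Fin (2 + 2 * n) → ℝ), K ⊆ pseudoSphere 2 (2 * n) ∧ IsCompact K ∧
        ∀ x ∈ pseudoSphere 2 (2 * n), ∃ γ ∈ Γ, ∃ y ∈ K,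
          ((γ : Matrix.GeneralLinearGroup (Fin (2 + 2 * n)) ℝ) :
              Matrix (Fin (2 + 2 * n)) (Fin (2 + 2 * n)) ℝ).mulVec y = x) := by
  have hS : ∀ x, x ∈ pseudoSphere 2 (2 * n) ↔ (AdSForm.cd n).h x x = 1 := AdSForm.cd_h n
  refine ⟨(AdSForm.cd n).G, ?_, ?_, (AdSForm.cd n).G_discrete, ?_, ?_, ?_⟩
  · intro γ hγ
    rw [← AdSForm.cd_η]
    exact (AdSForm.cd n).G_form γ hγ
  · refine (AdSForm.cd n).G_infinite ⟨2, by omega⟩ ?_ ?_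
    · simp [AdSForm.cd]
    · simp [AdSForm.cd]
  · rintro γ ⟨x, hx, h⟩
    exact (AdSForm.cd n).G_free γ x ((hS x).mp hx) h
  · intro K L hK hL cK cL
    exact (AdSForm.cd n).G_proper K L (fun x hx => (hS x).mp (hK hx))
      (fun x hx => (hS x).mp (hL hx)) cK cL
  · obtain ⟨K, hK, cK, h⟩ := (AdSForm.cd n).G_cocompact
    exact ⟨K, fun x hx => (hS x).mpr (hK x hx), cK, fun x hx => h x ((hS x).mp hx)⟩
end

section
/- (Benoist) Let n ≥ 3 be odd and let H be the subgroup of SL(n,ℝ) consisting of block matrices diag(A, 1) with A ∈ SL(n−1,ℝ), i.e., SL(n−1,ℝ) embedded in the upper-left corner. Then every discrete subgroup Γ of SL(n,ℝ) whose action by left multiplication on the coset space SL(n,ℝ)/H is properly discontinuous is virtually abelian, i.e., Γ contains an abelian subgroup of finite index. -/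
open Matrix

/-- The matrix topology on `SL(n, ℝ)`, induced from the space of matrices. -/
noncomputable instance (n : ℕ) : TopologicalSpace (Matrix.SpecialLinearGroup (Fin n) ℝ) :=
  TopologicalSpace.induced (fun g => (g : Matrix (Fin n) (Fin n) ℝ)) inferInstance

/-- Action of a matrix on Euclidean space. -/
noncomputable abbrev rho (n : ℕ) (g : Matrix (Fin n) (Fin n) ℝ) :
    EuclideanSpace ℝ (Fin n) →L[ℝ] EuclideanSpace ℝ (Fin n) :=
  toEuclideanCLM (n := Fin n) (𝕜 := ℝ) g

theorem abs1 {G : Type*} [Group G] (f L : G → ℝ) (hinv : ∀ x, f x⁻¹ = - f x)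
    (hl : ∀ a x, |f (a * x) - f x| ≤ L a) (hr : ∀ a x, |f (x * a) - f x| ≤ L a)
    (hfin : ∀ C : ℝ, {x | |f x| ≤ C}.Finite) (g : G) (hg : ¬ IsOfFinOrder g) :
    (Subgroup.zpowers g).FiniteIndex := by
  have hinj : Function.Injective (fun k : ℤ => g ^ k) := injective_zpow_iff_not_isOfFinOrder.2 hg
  have hunb : ∀ C : ℝ, ∃ k : ℤ, C < |f (g ^ k)| := by
    intro C
    by_contra! hcon
    exact Set.infinite_of_injective_forall_mem hinj (s := {x | |f x| ≤ C}) hcon (hfin C)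
  have hL : 0 ≤ L g := (abs_nonneg _).trans (hl g 1)
  have key : ∀ x : G, ∃ k : ℤ, |f (g ^ k * x)| ≤ L g := by
    intro x
    by_contra! hcon
    have hstep : ∀ k : ℤ, |f (g ^ (k + 1) * x) - f (g ^ k * x)| ≤ L g := by
      intro k
      have := hl g (g ^ k * x)
      rwa [← mul_assoc, ← _root_.zpow_one_add, add_comm] at this
    obtain ⟨k, hk⟩ := hunb (L x)
    have hk2 : f (g ^ (-k)) = - f (g ^ k) := by rw [_root_.zpow_neg, hinv]
    have h1 := abs_le.1 (hr x (g ^ k))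
    have h2 := abs_le.1 (hr x (g ^ (-k)))
    rw [hk2] at h2
    rcases lt_or_ge 0 (f (g ^ (0 : ℤ) * x)) with h0 | h0
    · have hall : ∀ j : ℤ, 0 < f (g ^ j * x) := by
        intro j
        induction j using Int.induction_on with
        | zero => exact h0
        | succ i ih =>
          have := abs_le.1 (hstep i)
          have h3 := hcon i
          rw [abs_of_pos ih] at h3
          linarith
        | pred i ih =>
          have := abs_le.1 (hstep (-i - 1))
          rw [sub_add_cancel] at this
          have h3 := hcon (-i)
          rw [abs_of_pos ih] at h3
          linarith
      have a1 := hall k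
      have a2 := hall (-k)
      rcases lt_abs.1 hk with h | h <;> linarith
    · have hall : ∀ j : ℤ, f (g ^ j * x) ≤ 0 := by
        intro j
        induction j using Int.induction_on with
        | zero => exact h0
        | succ i ih =>
          have := abs_le.1 (hstep i)
          have h3 := hcon i
          rw [abs_of_nonpos ih] at h3
          linarith
        | pred i ih =>
          have := abs_le.1 (hstep (-i - 1))
          rw [sub_add_cancel] at this
          have h3 := hcon (-i)
          rw [abs_of_nonpos ih] at h3
          linarith
      have a1 := hall k
      have a2 := hall (-k)
      rcases lt_abs.1 hk with h | h <;> linarith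
  have : Finite (G ⧸ Subgroup.zpowers g) := by
    have hF := (hfin (L g)).to_subtype
    refine Finite.of_surjective (fun y : {x | |f x| ≤ L g} =>
      QuotientGroup.mk (s := Subgroup.zpowers g) (y : G)⁻¹) ?_
    intro z
    obtain ⟨z, rfl⟩ := QuotientGroup.mk_surjective z
    obtain ⟨k, hk⟩ := key z⁻¹
    refine ⟨⟨g ^ k * z⁻¹, hk⟩, ?_⟩
    simp only [_root_.mul_inv_rev, inv_inv]
    rw [QuotientGroup.eq]
    exact ⟨k, by simp⟩
  exact Subgroup.finiteIndex_of_finite_quotient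

theorem abs2 {G : Type*} [Group G] (f L : G → ℝ) (hinv : ∀ x, f x⁻¹ = - f x)
    (hl : ∀ a x, |f (a * x) - f x| ≤ L a) (hr : ∀ a x, |f (x * a) - f x| ≤ L a)
    (hfin : ∀ C : ℝ, {x | |f x| ≤ C}.Finite) (S : Set G) (hS : S.Finite)
    (hgen : Subgroup.closure S = ⊤) [Infinite G] : ∃ g : G, ¬ IsOfFinOrder g := by
  have hbd : ∀ s : Set G, s.Finite → ∃ c, ∀ x ∈ s, L x ≤ c := by
    intro s hs
    obtain ⟨c, hc⟩ := (hs.image L).bddAbove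
    exact ⟨c, fun x hx => hc ⟨x, hx, rfl⟩⟩
  obtain ⟨c1, hc1⟩ := hbd S hS
  obtain ⟨c2, hc2⟩ := hbd (S⁻¹) hS.inv
  set c := max c1 c2 with hc
  obtain ⟨R, hR⟩ := hbd _ (hfin c)
  -- choose g with f g large
  obtain ⟨g, hg⟩ : ∃ g, |c| + |R| < f g := by
    by_contra! hcon
    refine Set.infinite_univ (α := G) ((hfin (|c| + |R|)).subset ?_)
    intro x _
    have h1 := hcon x
    have h2 := hcon x⁻¹
    rw [hinv] at h2
    exact abs_le.2 ⟨by linarith, h1⟩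
  have hcc := le_abs_self c
  have hRR := le_abs_self R
  have hf1 : f 1 = 0 := by have := hinv 1; rw [inv_one] at this; linarith
  have hB : ∀ x, 0 < f x → 0 < f (g * x) := by
    by_contra! hcon
    obtain ⟨x0, hx0, hx0'⟩ := hcon
    set B : Set G := {x | 0 < f x ∧ f (g * x) ≤ 0} with hBdef
    have hBfin : B.Finite := by
      refine (hfin (L g)).subset ?_
      rintro x ⟨h1, h2⟩
      have := abs_le.1 (hl g x)
      change |f x| ≤ L g
      exact abs_le.2 ⟨by linarith, by linarith⟩
    have hstep : ∀ s, L s ≤ c → ∀ x ∈ B, x * s ∈ B := by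
      rintro s hs x ⟨h1, h2⟩
      have e1 := abs_le.1 (hr s x)
      have e2 := abs_le.1 (hr s (g * x))
      rw [mul_assoc] at e2
      by_contra hnot
      rw [hBdef, Set.mem_ofPred_eq, not_and_or, not_lt, not_le] at hnot
      rcases hnot with h | h
      · have hxF : |f x| ≤ c := abs_le.2 ⟨by linarith, by linarith⟩
        have := abs_le.1 (hr x g)
        have := hR x hxF
        have := abs_nonneg c
        linarith
      · have hxF : |f (g * x)| ≤ c := abs_le.2 ⟨by linarith, by linarith⟩
        have e3 := abs_le.1 (hr (g * x) g⁻¹)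
        have e4 := hR _ hxF
        rw [inv_mul_cancel_left, hinv] at e3
        have := abs_nonneg c
        linarith
    have hall : ∀ y : G, x0 * y ∈ B := by
      intro y
      have hy : y ∈ Subgroup.closure S := by rw [hgen]; trivial
      induction hy using Subgroup.closure_induction_right with
      | one => simpa using ⟨hx0, hx0'⟩
      | mul_right x hx s hs ih =>
        rw [← mul_assoc]; exact hstep s ((hc1 s hs).trans (le_max_left _ _)) _ ih
      | mul_inv_cancel x hx s hs ih =>
        rw [← mul_assoc]
        exact hstep s⁻¹ ((hc2 s⁻¹ (by simpa using hs)).trans (le_max_right _ _)) _ ih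
    refine Set.infinite_univ (α := G) (hBfin.subset fun y _ => ?_)
    simpa using hall (x0⁻¹ * y)
  refine ⟨g, fun hfo => ?_⟩
  have hpow : ∀ k : ℕ, 0 < f (g ^ (k + 1)) := by
    intro k
    induction k with
    | zero => simpa using by linarith [abs_nonneg c, abs_nonneg R]
    | succ k ih => rw [pow_succ']; exact hB _ ih
  obtain ⟨k, hk, hk1⟩ := isOfFinOrder_iff_pow_eq_one.1 hfo
  obtain ⟨j, rfl⟩ := Nat.exists_eq_succ_of_ne_zero hk.ne'
  have := hpow j
  rw [Nat.succ_eq_add_one] at hk1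
  rw [hk1, hf1] at this
  exact lt_irrefl _ this
theorem rho_isom {n : ℕ} (U : Matrix (Fin n) (Fin n) ℝ) (hU : Uᵀ * U = 1)
    (x : EuclideanSpace ℝ (Fin n)) : ‖rho n U x‖ = ‖x‖ := by
  have h : ‖rho n U x‖ ^ 2 = ‖x‖ ^ 2 := by
    rw [← real_inner_self_eq_norm_sq, inner_toEuclideanCLM,
      ofLp_toEuclideanCLM, ← Matrix.dotProduct_transpose_mulVec, mulVec_mulVec, hU, one_mulVec]
    rw [EuclideanSpace.norm_sq_eq]
    simp [dotProduct, sq]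
  exact (pow_left_inj₀ (norm_nonneg _) (norm_nonneg _) two_ne_zero).1 h

/-- Unsorted singular value decomposition. -/
theorem svd0 {n : ℕ} (g : Matrix (Fin n) (Fin n) ℝ) (hg : g.det ≠ 0) :
    ∃ (U V : Matrix (Fin n) (Fin n) ℝ) (d : Fin n → ℝ), Uᵀ * U = 1 ∧ V * Vᵀ = 1 ∧
      (∀ i, 0 < d i) ∧ g = V * diagonal d * U := by
  have hinj : Function.Injective g.mulVec :=
    Matrix.mulVec_injective_iff_isUnit.2 ((Matrix.isUnit_iff_isUnit_det _).2 hg.isUnit)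
  have hpd : (gᴴ * g).PosDef := Matrix.PosDef.conjTranspose_mul_self g hinj
  have hH := hpd.isHermitian
  set W : Matrix (Fin n) (Fin n) ℝ := (hH.eigenvectorUnitary).1 with hW
  have hW1 : Wᵀ * W = 1 := by
    have := (Unitary.mem_iff.1 hH.eigenvectorUnitary.2).1
    rw [← conjTranspose_eq_transpose_of_trivial W]
    exact this
  have hW2 : W * Wᵀ = 1 := mul_eq_one_comm.1 hW1
  set d : Fin n → ℝ := fun i => Real.sqrt (hH.eigenvalues i) with hd
  have hdpos : ∀ i, 0 < d i := fun i => Real.sqrt_pos.2 (hpd.eigenvalues_pos i)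
  have hspec : gᵀ * g = W * diagonal d * diagonal d * Wᵀ := by
    have := hH.spectral_theorem
    rw [Unitary.conjStarAlgAut_apply] at this
    have hdd : diagonal d * diagonal d = diagonal (RCLike.ofReal ∘ hH.eigenvalues) := by
      rw [diagonal_mul_diagonal]
      congr 1
      ext i
      exact Real.mul_self_sqrt (hpd.eigenvalues_pos i).le
    rw [mul_assoc W, hdd, ← conjTranspose_eq_transpose_of_trivial W,
      ← conjTranspose_eq_transpose_of_trivial g]
    exact this
  have hdd : diagonal d * diagonal (fun i => (d i)⁻¹) = 1 := by
    rw [diagonal_mul_diagonal, ← diagonal_one]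
    congr 1; ext i; exact mul_inv_cancel₀ (hdpos i).ne'
  have hdd' : diagonal (fun i => (d i)⁻¹) * diagonal d = 1 := mul_eq_one_comm.1 hdd
  refine ⟨Wᵀ, g * W * diagonal (fun i => (d i)⁻¹), d, by simpa using hW2, ?_, hdpos, ?_⟩
  · rw [mul_eq_one_comm]
    simp only [transpose_mul, diagonal_transpose]
    calc _ = diagonal (fun i => (d i)⁻¹) * (Wᵀ * (gᵀ * g) * W) * diagonal (fun i => (d i)⁻¹) := by
          simp only [mul_assoc]
      _ = diagonal (fun i => (d i)⁻¹) * ((Wᵀ * W) * diagonal d * diagonal d * (Wᵀ * W)) *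
          diagonal (fun i => (d i)⁻¹) := by rw [hspec]; simp only [mul_assoc]
      _ = (diagonal (fun i => (d i)⁻¹) * diagonal d) * (diagonal d *
          diagonal (fun i => (d i)⁻¹)) := by rw [hW1]; simp only [mul_assoc, one_mul, mul_one]
      _ = 1 := by rw [hdd, hdd', one_mul]
  · rw [mul_assoc (g * W), hdd', mul_one, mul_assoc, hW2, mul_one]

theorem svd_perm {n : ℕ} (U V : Matrix (Fin n) (Fin n) ℝ) (d : Fin n → ℝ) (hU : Uᵀ * U = 1)
    (hV : V * Vᵀ = 1) (τ : Equiv.Perm (Fin n)) :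
    (U.submatrix τ id)ᵀ * (U.submatrix τ id) = 1 ∧
    (V.submatrix id τ) * (V.submatrix id τ)ᵀ = 1 ∧
    V.submatrix id τ * diagonal (d ∘ τ) * U.submatrix τ id = V * diagonal d * U := by
  refine ⟨?_, ?_, ?_⟩
  · rw [transpose_submatrix, submatrix_mul_equiv, hU, submatrix_id_id]
  · rw [transpose_submatrix, submatrix_mul_equiv, hV, submatrix_id_id]
  · have : diagonal (d ∘ τ) = (diagonal d).submatrix τ τ := by
      rw [submatrix_diagonal_equiv]
    rw [this, submatrix_mul_equiv, submatrix_mul_equiv, submatrix_id_id]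

/-- Sorted singular value decomposition. -/
theorem svd1 {n : ℕ} (g : Matrix (Fin n) (Fin n) ℝ) (hg : g.det ≠ 0) :
    ∃ (U V : Matrix (Fin n) (Fin n) ℝ) (d : Fin n → ℝ), Uᵀ * U = 1 ∧ V * Vᵀ = 1 ∧
      (∀ i, 0 < d i) ∧ Monotone d ∧ g = V * diagonal d * U := by
  obtain ⟨U, V, d, hU, hV, hd, h⟩ := svd0 g hg
  obtain ⟨h1, h2, h3⟩ := svd_perm U V d hU hV (Tuple.sort d)
  exact ⟨_, _, _, h1, h2, fun i => hd _, Tuple.monotone_sort d, h.trans h3.symm⟩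

def PP (m n : ℕ) (T : EuclideanSpace ℝ (Fin n) →L[ℝ] EuclideanSpace ℝ (Fin n)) (t : ℝ) : Prop :=
  ∃ φ : (Fin (m + 1) → ℝ) →ₗ[ℝ] EuclideanSpace ℝ (Fin n), Function.Injective φ ∧
    ∀ x, t * ‖φ x‖ ≤ ‖T (φ x)‖

def QQ (m n : ℕ) (T : EuclideanSpace ℝ (Fin n) →L[ℝ] EuclideanSpace ℝ (Fin n)) (t : ℝ) : Prop :=
  ∃ φ : (Fin (m + 1) → ℝ) →ₗ[ℝ] EuclideanSpace ℝ (Fin n), Function.Injective φ ∧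
    ∀ x, ‖T (φ x)‖ ≤ t * ‖φ x‖

theorem PP_QQ {m n : ℕ} (hn : n = 2 * m + 1)
    {T : EuclideanSpace ℝ (Fin n) →L[ℝ] EuclideanSpace ℝ (Fin n)} {s t : ℝ}
    (hP : PP m n T s) (hQ : QQ m n T t) : s ≤ t := by
  obtain ⟨φ, hφ, h1⟩ := hP
  obtain ⟨ψ, hψ, h2⟩ := hQ
  have hker : LinearMap.ker (φ.coprod (-ψ)) ≠ ⊥ := by
    apply LinearMap.ker_ne_bot_of_finrank_lt
    simp; omega
  obtain ⟨⟨x, y⟩, hxy, hne⟩ := Submodule.exists_mem_ne_zero_of_ne_bot hker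
  have he : φ x = ψ y := by
    simpa [LinearMap.mem_ker, add_neg_eq_zero] using hxy
  have hx : φ x ≠ 0 := by
    intro h0
    apply hne
    have e1 : x = 0 := hφ (by simpa using h0)
    have e2 : y = 0 := hψ (by rw [← he, h0, map_zero])
    simp [e1, e2]
  have hpos : 0 < ‖φ x‖ := norm_pos_iff.2 hx
  have := (h1 x).trans (he ▸ h2 y)
  exact le_of_mul_le_mul_right this hpos

theorem QQ_left {m n : ℕ} {T A : EuclideanSpace ℝ (Fin n) →L[ℝ] EuclideanSpace ℝ (Fin n)} {t : ℝ}
    (hQ : QQ m n T t) : QQ m n (A * T) (‖A‖ * t) := by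
  obtain ⟨φ, hφ, h1⟩ := hQ
  refine ⟨φ, hφ, fun x => ?_⟩
  calc ‖A (T (φ x))‖ ≤ ‖A‖ * ‖T (φ x)‖ := A.le_opNorm _
    _ ≤ ‖A‖ * (t * ‖φ x‖) := by gcongr; exact h1 x
    _ = _ := by ring

theorem QQ_right {m n : ℕ} {T B B' : EuclideanSpace ℝ (Fin n) →L[ℝ] EuclideanSpace ℝ (Fin n)}
    {t : ℝ} (ht : 0 ≤ t) (hB : B * B' = 1)
    (hQ : QQ m n T t) : QQ m n (T * B) (‖B‖ * t) := by
  obtain ⟨φ, hφ, h1⟩ := hQ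
  have hBB : ∀ v, B (B' v) = v := fun v => congrArg (fun S => S v) hB
  refine ⟨B'.toLinearMap ∘ₗ φ, ?_, fun x => ?_⟩
  · intro x y hxy
    apply hφ
    have := congrArg B hxy
    simpa [hBB] using this
  · change ‖T (B (B' (φ x)))‖ ≤ _ * ‖B' (φ x)‖
    rw [hBB]
    calc _ ≤ t * ‖φ x‖ := h1 x
      _ = t * ‖B (B' (φ x))‖ := by rw [hBB]
      _ ≤ t * (‖B‖ * ‖B' (φ x)‖) := by gcongr; exact B.le_opNorm _
      _ = _ := by ring

theorem PP_inv {m n : ℕ} {T T' : EuclideanSpace ℝ (Fin n) →L[ℝ] EuclideanSpace ℝ (Fin n)} {t : ℝ}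
    (ht : 0 < t) (hT : T' * T = 1) (hQ : QQ m n T t) : PP m n T' t⁻¹ := by
  obtain ⟨φ, hφ, h1⟩ := hQ
  have hTT : ∀ v, T' (T v) = v := fun v => congrArg (fun S => S v) hT
  refine ⟨T.toLinearMap ∘ₗ φ, ?_, fun x => ?_⟩
  · intro x y hxy
    apply hφ
    have := congrArg T' hxy
    simpa [hTT] using this
  · change _ * ‖T (φ x)‖ ≤ ‖T' (T (φ x))‖
    rw [hTT, inv_mul_le_iff₀ ht]
    exact h1 x

theorem QQ_inv {m n : ℕ} {T T' : EuclideanSpace ℝ (Fin n) →L[ℝ] EuclideanSpace ℝ (Fin n)} {t : ℝ}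
    (ht : 0 < t) (hT : T' * T = 1) (hQ : PP m n T t) : QQ m n T' t⁻¹ := by
  obtain ⟨φ, hφ, h1⟩ := hQ
  have hTT : ∀ v, T' (T v) = v := fun v => congrArg (fun S => S v) hT
  refine ⟨T.toLinearMap ∘ₗ φ, ?_, fun x => ?_⟩
  · intro x y hxy
    apply hφ
    have := congrArg T' hxy
    simpa [hTT] using this
  · change ‖T' (T (φ x))‖ ≤ _ * ‖T (φ x)‖
    rw [hTT, le_inv_mul_iff₀ ht]
    exact h1 x

/-- the linear embedding of coordinates used for the min-max spaces -/
noncomputable def emb {m n : ℕ} (U : Matrix (Fin n) (Fin n) ℝ) (I : Fin (m + 1) → Fin n) :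
    (Fin (m + 1) → ℝ) →ₗ[ℝ] EuclideanSpace ℝ (Fin n) :=
  (rho n Uᵀ).toLinearMap ∘ₗ (WithLp.linearEquiv 2 ℝ (Fin n → ℝ)).symm.toLinearMap ∘ₗ
    Function.ExtendByZero.linearMap ℝ I

theorem emb_facts {m n : ℕ} {U V : Matrix (Fin n) (Fin n) ℝ} {d : Fin n → ℝ} (hU : Uᵀ * U = 1)
    (hV : V * Vᵀ = 1) (I : Fin (m + 1) → Fin n) (hI : Function.Injective I) :
    Function.Injective (emb U I) ∧ ∀ x, ∃ v : EuclideanSpace ℝ (Fin n),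
      ‖emb U I x‖ = ‖v‖ ∧
      ‖rho n (V * diagonal d * U) (emb U I x)‖ = ‖rho n (diagonal d) v‖ ∧
      ∀ i, (∀ k, I k ≠ i) → v i = 0 := by
  have hUt : (Uᵀ)ᵀ * Uᵀ = 1 := by rw [transpose_transpose]; exact mul_eq_one_comm.1 hU
  have hV' : Vᵀ * V = 1 := mul_eq_one_comm.1 hV
  have hnorm : ∀ x, ‖emb U I x‖ = ‖(WithLp.toLp 2 (Function.ExtendByZero.linearMap ℝ I x) :
      EuclideanSpace ℝ (Fin n))‖ := fun x => rho_isom _ hUt _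
  refine ⟨?_, fun x => ⟨WithLp.toLp 2 (Function.ExtendByZero.linearMap ℝ I x), hnorm x, ?_, ?_⟩⟩
  · rw [injective_iff_map_eq_zero]
    intro x hx
    have h := hnorm x
    rw [hx, norm_zero, eq_comm, norm_eq_zero] at h
    ext k
    have h2 := congrArg (fun v : EuclideanSpace ℝ (Fin n) => v (I k)) h
    simpa [hI.extend_apply] using h2
  · have : rho n (V * diagonal d * U) (emb U I x) = rho n V (rho n (diagonal d)
        (WithLp.toLp 2 (Function.ExtendByZero.linearMap ℝ I x))) := by
      change rho n (V * diagonal d * U) (rho n Uᵀ _) = _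
      have e : V * diagonal d = V * diagonal d * U * Uᵀ := by
        rw [mul_assoc, mul_eq_one_comm.1 hU, mul_one]
      rw [← mul_apply_eq_comp, ← map_mul, ← e, map_mul]
      rfl
    rw [this, rho_isom _ hV']
  · intro i hi
    exact Function.extend_apply' _ _ _ (by rintro ⟨k, hk⟩; exact hi k hk)

theorem norm_le_of_coord {n : ℕ} (v w : EuclideanSpace ℝ (Fin n)) (h : ∀ i, |v i| ≤ |w i|) :
    ‖v‖ ≤ ‖w‖ := by
  rw [EuclideanSpace.norm_eq, EuclideanSpace.norm_eq]
  apply Real.sqrt_le_sqrt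
  apply Finset.sum_le_sum
  intro i _
  exact pow_le_pow_left₀ (norm_nonneg _) (h i) 2

theorem svd_PQ {m n : ℕ} (hn : n = 2 * m + 1) {U V : Matrix (Fin n) (Fin n) ℝ} {d : Fin n → ℝ}
    (hU : Uᵀ * U = 1) (hV : V * Vᵀ = 1) (hd : ∀ i, 0 < d i) (hmono : Monotone d) :
    PP m n (rho n (V * diagonal d * U)) (d ⟨m, by omega⟩) ∧
    QQ m n (rho n (V * diagonal d * U)) (d ⟨m, by omega⟩) := by
  constructor
  · set I : Fin (m + 1) → Fin n := fun k => ⟨m + k, by omega⟩ with hI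
    obtain ⟨h1, h2⟩ := emb_facts (d := d) hU hV I (fun a b h => by
      simp only [hI, Fin.mk.injEq] at h; ext; omega)
    refine ⟨_, h1, fun x => ?_⟩
    obtain ⟨v, e1, e2, e3⟩ := h2 x
    rw [e1, e2, ← abs_of_pos (hd ⟨m, by omega⟩), ← Real.norm_eq_abs, ← norm_smul]
    apply norm_le_of_coord
    intro i
    simp only [PiLp.smul_apply, smul_eq_mul, ofLp_toEuclideanCLM, mulVec_diagonal, abs_mul]
    by_cases hi : m ≤ (i : ℕ)
    · rw [abs_of_pos (hd _), abs_of_pos (hd _)]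
      exact mul_le_mul_of_nonneg_right (hmono hi) (abs_nonneg _)
    · rw [e3 i (by intro k hk; apply hi; rw [← hk]; simp [hI])]
      simp
  · set I : Fin (m + 1) → Fin n := fun k => ⟨k, by omega⟩ with hI
    obtain ⟨h1, h2⟩ := emb_facts (d := d) hU hV I (fun a b h => by
      simp only [hI, Fin.mk.injEq] at h; ext; omega)
    refine ⟨_, h1, fun x => ?_⟩
    obtain ⟨v, e1, e2, e3⟩ := h2 x
    rw [e1, e2, ← abs_of_pos (hd ⟨m, by omega⟩), ← Real.norm_eq_abs, ← norm_smul]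
    apply norm_le_of_coord
    intro i
    simp only [PiLp.smul_apply, smul_eq_mul, ofLp_toEuclideanCLM, mulVec_diagonal, abs_mul]
    by_cases hi : (i : ℕ) ≤ m
    · rw [abs_of_pos (hd _), abs_of_pos (hd _)]
      exact mul_le_mul_of_nonneg_right (hmono hi) (abs_nonneg _)
    · rw [e3 i (by intro k hk; apply hi; rw [← hk]; simp only [hI]; omega)]
      simp

/-- The middle Cartan coordinate. -/
theorem exists_mid {m n : ℕ} (hn : n = 2 * m + 1) :
    ∃ f : Matrix.SpecialLinearGroup (Fin n) ℝ → ℝ,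
      (∀ x, f x⁻¹ = - f x) ∧
      (∀ a x, |f (a * x) - f x| ≤
        Real.log (max ‖rho n (a : Matrix (Fin n) (Fin n) ℝ)‖
          ‖rho n ((a⁻¹ : Matrix.SpecialLinearGroup (Fin n) ℝ) : Matrix (Fin n) (Fin n) ℝ)‖)) ∧
      (∀ a x, |f (x * a) - f x| ≤
        Real.log (max ‖rho n (a : Matrix (Fin n) (Fin n) ℝ)‖
          ‖rho n ((a⁻¹ : Matrix.SpecialLinearGroup (Fin n) ℝ) : Matrix (Fin n) (Fin n) ℝ)‖)) ∧
      ∀ g : Matrix.SpecialLinearGroup (Fin n) ℝ, ∃ (U V : Matrix (Fin n) (Fin n) ℝ) (d : Fin n → ℝ),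
        Uᵀ * U = 1 ∧ V * Vᵀ = 1 ∧ (∀ i, 0 < d i) ∧
        (g : Matrix (Fin n) (Fin n) ℝ) = V * diagonal d * U ∧
        d ⟨n - 1, by omega⟩ = Real.exp (f g) := by
  have hex : ∀ g : Matrix.SpecialLinearGroup (Fin n) ℝ, ∃ s : ℝ, 0 < s ∧
      PP m n (rho n g) s ∧ QQ m n (rho n g) s ∧
      ∃ (U V : Matrix (Fin n) (Fin n) ℝ) (d : Fin n → ℝ),
        Uᵀ * U = 1 ∧ V * Vᵀ = 1 ∧ (∀ i, 0 < d i) ∧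
        (g : Matrix (Fin n) (Fin n) ℝ) = V * diagonal d * U ∧
        d ⟨n - 1, by omega⟩ = s := by
    intro g
    obtain ⟨U, V, d, hU, hV, hd, hmono, h⟩ := svd1 (g : Matrix (Fin n) (Fin n) ℝ) (by simp)
    obtain ⟨hP, hQ⟩ := svd_PQ hn hU hV hd hmono
    rw [← h] at hP hQ
    obtain ⟨h1, h2, h3⟩ := svd_perm U V d hU hV
      (Equiv.swap (⟨n - 1, by omega⟩ : Fin n) ⟨m, by omega⟩)
    refine ⟨_, hd _, hP, hQ, _, _, _, h1, h2, fun i => hd _, h.trans h3.symm, ?_⟩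
    simp
  choose s hs hP hQ hsvd using hex
  have hone : ∀ a : Matrix.SpecialLinearGroup (Fin n) ℝ, rho n (a : Matrix (Fin n) (Fin n) ℝ) *
      rho n ((a⁻¹ : Matrix.SpecialLinearGroup (Fin n) ℝ) : Matrix (Fin n) (Fin n) ℝ) = 1 := by
    intro a
    rw [← map_mul, ← Matrix.SpecialLinearGroup.coe_mul, mul_inv_cancel, Matrix.SpecialLinearGroup.coe_one,
      map_one]
  have hone' : ∀ a : Matrix.SpecialLinearGroup (Fin n) ℝ,
      rho n ((a⁻¹ : Matrix.SpecialLinearGroup (Fin n) ℝ) : Matrix (Fin n) (Fin n) ℝ) *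
      rho n (a : Matrix (Fin n) (Fin n) ℝ) = 1 := by
    intro a
    rw [← map_mul, ← Matrix.SpecialLinearGroup.coe_mul, inv_mul_cancel, Matrix.SpecialLinearGroup.coe_one,
      map_one]
  have hinv : ∀ x, s x⁻¹ = (s x)⁻¹ := by
    intro x
    apply le_antisymm
    · exact PP_QQ hn (hP _) (QQ_inv (hs x) (hone' x) (hP x))
    · exact PP_QQ hn (PP_inv (hs x) (hone' x) (hQ x)) (hQ _)
  have hleft : ∀ a x, s (a * x) ≤ ‖rho n (a : Matrix (Fin n) (Fin n) ℝ)‖ * s x := by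
    intro a x
    refine PP_QQ hn (hP _) ?_
    rw [Matrix.SpecialLinearGroup.coe_mul, rho, map_mul]
    exact QQ_left (hQ x)
  have hright : ∀ a x, s (x * a) ≤ ‖rho n (a : Matrix (Fin n) (Fin n) ℝ)‖ * s x := by
    intro a x
    refine PP_QQ hn (hP _) ?_
    rw [Matrix.SpecialLinearGroup.coe_mul, rho, map_mul]
    exact QQ_right (hs x).le (hone a) (hQ x)
  have hlog : ∀ (M p q u v : ℝ), 0 < p → 0 < q → p ≤ u * q → q ≤ v * p → M = max u v →
      |Real.log p - Real.log q| ≤ Real.log M := by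
    rintro M p q u v hp hq h1 h2 rfl
    have h1' : p ≤ max u v * q := h1.trans (by gcongr; exact le_max_left _ _)
    have h2' : q ≤ max u v * p := h2.trans (by gcongr; exact le_max_right _ _)
    have hM : 0 < max u v := by
      by_contra hcon
      have : max u v * q ≤ 0 := mul_nonpos_of_nonpos_of_nonneg (not_lt.1 hcon) hq.le
      linarith
    have l1 := Real.log_le_log hp h1'
    have l2 := Real.log_le_log hq h2'
    rw [Real.log_mul hM.ne' hq.ne'] at l1
    rw [Real.log_mul hM.ne' hp.ne'] at l2
    exact abs_le.2 ⟨by linarith, by linarith⟩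
  refine ⟨fun x => Real.log (s x), fun x => by simp only [hinv, Real.log_inv], ?_, ?_, ?_⟩
  · intro a x
    refine hlog _ _ _ _ _ (hs _) (hs _) (hleft a x) ?_ rfl
    simpa using hleft a⁻¹ (a * x)
  · intro a x
    refine hlog _ _ _ _ _ (hs _) (hs _) (hright a x) ?_ rfl
    simpa using hright a⁻¹ (x * a)
  · intro g
    obtain ⟨U, V, d, h1, h2, h3, h4, h5⟩ := hsvd g
    exact ⟨U, V, d, h1, h2, h3, h4, by rw [h5, Real.exp_log (hs g)]⟩

theorem locfin_bdd {n : ℕ} (Γ : Subgroup (Matrix.SpecialLinearGroup (Fin n) ℝ))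
    (h : ∀ S : Finset Γ, Finite (Subgroup.closure (S : Set Γ))) :
    ∃ C : ℝ, ∀ γ : Γ, ‖rho n (γ : Matrix.SpecialLinearGroup (Fin n) ℝ).1‖ ≤ C := by
  classical
  let M : Γ → Matrix (Fin n) (Fin n) ℝ := fun γ => (γ : Matrix.SpecialLinearGroup (Fin n) ℝ).1
  have hM : ∀ a b, M (a * b) = M a * M b := fun a b => rfl
  let W : Finset Γ → Submodule ℝ (Matrix (Fin n) (Fin n) ℝ) := fun S =>
    { carrier := {A | ∀ γ ∈ S, (M γ)ᵀ * A * M γ = A}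
      add_mem' := by
        intro a b ha hb γ hγ
        rw [mul_add, add_mul, ha γ hγ, hb γ hγ]
      zero_mem' := by intro γ hγ; simp
      smul_mem' := by
        intro c a ha γ hγ
        rw [mul_smul_comm, smul_mul_assoc, ha γ hγ] }
  obtain ⟨S, hS⟩ : ∃ S, ∀ T, Module.finrank ℝ (W S) ≤ Module.finrank ℝ (W T) := by
    exact ⟨Function.argmin (fun S => Module.finrank ℝ (W S)),
      fun T => Function.argmin_le (fun S => Module.finrank ℝ (W S)) T⟩
  have hinvar : ∀ A ∈ W S, ∀ γ : Γ, (M γ)ᵀ * A * M γ = A := by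
    intro A hA γ
    have hle : W (insert γ S) ≤ W S := fun B hB δ hδ => hB δ (Finset.mem_insert_of_mem hδ)
    have heq := Submodule.eq_of_le_of_finrank_le hle (hS _)
    rw [← heq] at hA
    exact hA γ (Finset.mem_insert_self _ _)
  have hfinS := h S
  have := Fintype.ofFinite (Subgroup.closure (S : Set Γ))
  set P : Matrix (Fin n) (Fin n) ℝ := ∑ δ : Subgroup.closure (S : Set Γ), (M δ)ᵀ * M δ with hPdef
  have hP : P ∈ W S := by
    intro γ hγ
    rw [hPdef, Finset.mul_sum, Finset.sum_mul]
    let γ' : Subgroup.closure (S : Set Γ) := ⟨γ, Subgroup.subset_closure hγ⟩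
    refine Fintype.sum_equiv (Equiv.mulRight γ') _ _ ?_
    intro δ
    change _ = (M (δ * γ))ᵀ * M (δ * γ)
    rw [hM, transpose_mul]
    simp only [mul_assoc]
  have hQ : ∀ x : EuclideanSpace ℝ (Fin n), x.ofLp ⬝ᵥ (P *ᵥ x.ofLp) ≤ ‖rho n P‖ * ‖x‖ ^ 2 := by
    intro x
    rw [← inner_toEuclideanCLM]
    calc _ ≤ ‖x‖ * ‖rho n P x‖ := real_inner_le_norm _ _
      _ ≤ ‖x‖ * (‖rho n P‖ * ‖x‖) := by gcongr; exact (rho n P).le_opNorm x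
      _ = _ := by ring
  have hnormsq : ∀ (A : Matrix (Fin n) (Fin n) ℝ) (x : EuclideanSpace ℝ (Fin n)),
      ‖rho n A x‖ ^ 2 = x.ofLp ⬝ᵥ ((Aᵀ * A) *ᵥ x.ofLp) := by
    intro A x
    rw [← real_inner_self_eq_norm_sq, inner_toEuclideanCLM,
      ofLp_toEuclideanCLM, ← Matrix.dotProduct_transpose_mulVec, mulVec_mulVec]
  have hQ2 : ∀ x : EuclideanSpace ℝ (Fin n), ‖x‖ ^ 2 ≤ x.ofLp ⬝ᵥ (P *ᵥ x.ofLp) := by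
    intro x
    rw [hPdef, sum_mulVec, dotProduct_sum]
    have h1 : ‖x‖ ^ 2 = x.ofLp ⬝ᵥ (((M ((1 : Subgroup.closure (S : Set Γ)) : Γ))ᵀ *
        M ((1 : Subgroup.closure (S : Set Γ)) : Γ)) *ᵥ x.ofLp) := by
      rw [← hnormsq]
      have : M ((1 : Subgroup.closure (S : Set Γ)) : Γ) = 1 := rfl
      rw [this, rho, map_one]
      rfl
    rw [h1]
    exact Finset.single_le_sum
      (f := fun δ : Subgroup.closure (S : Set Γ) => x.ofLp ⬝ᵥ (((M δ)ᵀ * M δ) *ᵥ x.ofLp))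
      (fun δ _ => by rw [← hnormsq]; positivity) (Finset.mem_univ 1)
  refine ⟨Real.sqrt ‖rho n P‖, fun γ => ?_⟩
  refine ContinuousLinearMap.opNorm_le_bound _ (Real.sqrt_nonneg _) fun x => ?_
  refine abs_le_of_sq_le_sq' ?_ (by positivity) |>.2
  rw [mul_pow, Real.sq_sqrt (norm_nonneg _)]
  refine (hQ2 _).trans (le_trans (le_of_eq ?_) (hQ x))
  change (M γ *ᵥ x.ofLp) ⬝ᵥ (P *ᵥ (M γ *ᵥ x.ofLp)) = _
  conv_rhs => rw [← hinvar P hP γ]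
  rw [← mulVec_mulVec, ← mulVec_mulVec, Matrix.dotProduct_transpose_mulVec]
  exact dotProduct_comm _ _

theorem compact_box (n : ℕ) (R : ℝ) :
    IsCompact {g : Matrix.SpecialLinearGroup (Fin n) ℝ | ∀ i j, |g.1 i j| ≤ R} := by
  have hind : Topology.IsInducing
      (fun g : Matrix.SpecialLinearGroup (Fin n) ℝ => (g : Matrix (Fin n) (Fin n) ℝ)) := ⟨rfl⟩
  rw [hind.isCompact_iff]
  have hbox : IsCompact {A : Matrix (Fin n) (Fin n) ℝ | ∀ i j, A i j ∈ Set.Icc (-R) R} := by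
    have := isCompact_univ_pi (fun _ : Fin n => isCompact_univ_pi
      (fun _ : Fin n => isCompact_Icc (a := -R) (b := R)))
    have e : {A : Matrix (Fin n) (Fin n) ℝ | ∀ i j, A i j ∈ Set.Icc (-R) R} =
        (Set.pi Set.univ fun _ : Fin n => Set.pi Set.univ fun _ : Fin n => Set.Icc (-R) R) := by
      ext A
      exact ⟨fun h i _ j _ => h i j, fun h i j => h i trivial j trivial⟩
    rw [e]
    exact this
  have hcl : IsClosed {A : Matrix (Fin n) (Fin n) ℝ | A.det = 1} :=
    isClosed_eq (continuous_id.matrix_det) continuous_const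
  convert hbox.inter_right hcl using 1
  ext A
  constructor
  · rintro ⟨g, hg, rfl⟩
    exact ⟨fun i j => abs_le.1 (hg i j), g.2⟩
  · rintro ⟨h1, h2⟩
    exact ⟨⟨A, h2⟩, fun i j => abs_le.2 (h1 i j), rfl⟩

theorem svd_sign {n : ℕ} (hodd : Odd n) (g : Matrix (Fin n) (Fin n) ℝ) (hg : g.det = 1)
    (U V : Matrix (Fin n) (Fin n) ℝ) (d : Fin n → ℝ) (hU : Uᵀ * U = 1) (hV : V * Vᵀ = 1)
    (hd : ∀ i, 0 < d i) (h : g = V * diagonal d * U) :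
    ∃ (U V : Matrix (Fin n) (Fin n) ℝ), U.det = 1 ∧ V.det = 1 ∧ Uᵀ * U = 1 ∧ V * Vᵀ = 1 ∧
      g = V * diagonal d * U := by
  have h1 : U.det * U.det = 1 := by
    have := congrArg det hU
    simpa using this
  have h2 : V.det * V.det = 1 := by
    have := congrArg det hV
    simpa using this
  have h3 : V.det * (∏ i, d i) * U.det = 1 := by
    rw [← hg, h]; simp
  have hp : 0 < ∏ i, d i := Finset.prod_pos fun i _ => hd i
  rcases mul_self_eq_one_iff.1 h1 with hu | hu <;> rcases mul_self_eq_one_iff.1 h2 with hv | hv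
  · exact ⟨U, V, hu, hv, hU, hV, h⟩
  · rw [hu, hv] at h3; linarith
  · rw [hu, hv] at h3; linarith
  · refine ⟨-U, -V, ?_, ?_, by simpa using hU, by simpa using hV, by simpa using h⟩
    · rw [det_neg, hu]; simp [hodd.neg_one_pow]
    · rw [det_neg, hv]; simp [hodd.neg_one_pow]

theorem orth_entry {n : ℕ} (U : Matrix (Fin n) (Fin n) ℝ) (hU : U * Uᵀ = 1) (i j : Fin n) :
    |U i j| ≤ 1 := by
  have hmem : U ∈ Matrix.unitaryGroup (Fin n) ℝ := by
    rw [Matrix.mem_unitaryGroup_iff, star_eq_conjTranspose, conjTranspose_eq_transpose_of_trivial]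
    exact hU
  exact entry_norm_bound_of_unitary hmem i j

theorem coset_lemma {n : ℕ} (hn : 3 ≤ n) (hodd : Odd n)
    (H : Subgroup (Matrix.SpecialLinearGroup (Fin n) ℝ))
    (hH : (H : Set (Matrix.SpecialLinearGroup (Fin n) ℝ)) =
      {g : Matrix.SpecialLinearGroup (Fin n) ℝ | ∀ i j : Fin n, (n - 1 ≤ (i : ℕ) ∨ n - 1 ≤ (j : ℕ)) →
        (g : Matrix (Fin n) (Fin n) ℝ) i j = if i = j then 1 else 0})
    (g : Matrix.SpecialLinearGroup (Fin n) ℝ) (t C : ℝ) (ht : |t| ≤ C)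
    (U V : Matrix (Fin n) (Fin n) ℝ) (d : Fin n → ℝ)
    (hU : Uᵀ * U = 1) (hV : V * Vᵀ = 1) (hd : ∀ i, 0 < d i)
    (hg : (g : Matrix (Fin n) (Fin n) ℝ) = V * diagonal d * U)
    (hlast : d ⟨n - 1, by omega⟩ = Real.exp t) :
    ∃ x ∈ (QuotientGroup.mk : _ → Matrix.SpecialLinearGroup (Fin n) ℝ ⧸ H) ''
        {g : Matrix.SpecialLinearGroup (Fin n) ℝ | ∀ i j, |g.1 i j| ≤ Real.exp C},
      g • x ∈ (QuotientGroup.mk : _ → Matrix.SpecialLinearGroup (Fin n) ℝ ⧸ H) ''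
        {g : Matrix.SpecialLinearGroup (Fin n) ℝ | ∀ i j, |g.1 i j| ≤ Real.exp C} := by
  obtain ⟨U, V, hdU, hdV, hU, hV, hg⟩ := svd_sign hodd g.1 g.2 U V d hU hV hd hg
  have hC : 0 ≤ C := (abs_nonneg _).trans ht
  have hUU : U * Uᵀ = 1 := mul_eq_one_comm.1 hU
  set l : Fin n := ⟨n - 1, by omega⟩ with hl
  have hn1 : (0 : ℝ) < ((n - 1 : ℕ) : ℝ) := by exact_mod_cast (by omega : 0 < n - 1)
  set c : Fin n → ℝ := Function.update (fun _ => Real.exp (t / ((n - 1 : ℕ) : ℝ))) l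
    (Real.exp (-t)) with hc
  have hprod : ∏ i, c i = 1 := by
    rw [hc, Finset.prod_update_of_mem (Finset.mem_univ l), Finset.prod_const,
      ← Finset.compl_eq_univ_sdiff, Finset.card_compl, Finset.card_singleton, Fintype.card_fin,
      ← Real.exp_nat_mul, mul_div_cancel₀ _ hn1.ne', ← Real.exp_add]
    simp
  have hcb : ∀ i, |c i| ≤ Real.exp C := by
    intro i
    by_cases hi : i = l
    · rw [hi, hc, Function.update_self, Real.abs_exp]
      exact Real.exp_le_exp.2 ((neg_le_abs t).trans ht)
    · rw [hc, Function.update_of_ne hi, Real.abs_exp]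
      refine Real.exp_le_exp.2 ((le_abs_self _).trans ?_)
      rw [abs_div, abs_of_pos hn1]
      refine (div_le_self (abs_nonneg _) ?_).trans ht
      exact_mod_cast (by omega : 1 ≤ n - 1)
  let Y : Matrix.SpecialLinearGroup (Fin n) ℝ := ⟨Uᵀ * diagonal c, by simp [hdU, hprod]⟩
  let V' : Matrix.SpecialLinearGroup (Fin n) ℝ := ⟨V, hdV⟩
  have hgY : (g * Y).1 = V * diagonal (fun i => d i * c i) := by
    change g.1 * (Uᵀ * diagonal c) = _
    rw [hg, ← diagonal_mul_diagonal]
    calc _ = V * diagonal d * (U * Uᵀ) * diagonal c := by simp only [mul_assoc]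
      _ = _ := by rw [hUU, mul_one, mul_assoc]
  have hVt : ((V'⁻¹ : Matrix.SpecialLinearGroup (Fin n) ℝ)).1 * V = 1 := by
    change ((V'⁻¹ : Matrix.SpecialLinearGroup (Fin n) ℝ)).1 * V'.1 = 1
    rw [← Matrix.SpecialLinearGroup.coe_mul, inv_mul_cancel, Matrix.SpecialLinearGroup.coe_one]
  have hmem : V'⁻¹ * (g * Y) ∈ H := by
    rw [← SetLike.mem_coe, hH]
    intro i j hij
    rw [Matrix.SpecialLinearGroup.coe_mul, hgY, ← mul_assoc, hVt, one_mul, diagonal_apply]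
    by_cases he : i = j
    · subst he
      have hi : i = l := by
        apply Fin.ext
        have := i.2
        simp only [hl]
        omega
      rw [if_pos rfl, if_pos rfl, hi, hlast, hc, Function.update_self, ← Real.exp_add]
      simp
    · rw [if_neg he, if_neg he]
  refine ⟨QuotientGroup.mk Y, ⟨Y, ?_, rfl⟩, V', ?_, ?_⟩
  · intro i j
    change |(Uᵀ * diagonal c) i j| ≤ _
    rw [mul_diagonal, abs_mul]
    calc _ ≤ 1 * |c j| := by gcongr; exact orth_entry U hUU j i
      _ ≤ _ := by rw [one_mul]; exact hcb j
  · intro i j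
    exact (orth_entry V hV i j).trans (Real.one_le_exp hC)
  · exact QuotientGroup.eq.2 hmem
theorem benoist_virtually_abelian (n : ℕ) (hn : 3 ≤ n) (hodd : Odd n)
    (H : Subgroup (Matrix.SpecialLinearGroup (Fin n) ℝ))
    (hH : (H : Set (Matrix.SpecialLinearGroup (Fin n) ℝ)) =
      {g : Matrix.SpecialLinearGroup (Fin n) ℝ | ∀ i j : Fin n, (n - 1 ≤ (i : ℕ) ∨ n - 1 ≤ (j : ℕ)) →
        (g : Matrix (Fin n) (Fin n) ℝ) i j = if i = j then 1 else 0})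
    (Γ : Subgroup (Matrix.SpecialLinearGroup (Fin n) ℝ))
    (hdisc : DiscreteTopology Γ)
    (hpd : ∀ K L : Set (Matrix.SpecialLinearGroup (Fin n) ℝ ⧸ H),
      IsCompact K → IsCompact L →
      {γ : Γ | ∃ x ∈ K, ((γ : Matrix.SpecialLinearGroup (Fin n) ℝ) • x) ∈ L}.Finite) :
    ∃ A : Subgroup Γ, A.FiniteIndex ∧ ∀ a ∈ A, ∀ b ∈ A, a * b = b * a := by
  classical
  obtain ⟨m, hm⟩ := id hodd
  obtain ⟨f, hinv, hl, hr, hsvd⟩ := exists_mid hm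
  let F : Γ → ℝ := fun γ => f γ.1
  let L : Γ → ℝ := fun γ => Real.log (max ‖rho n γ.1.1‖ ‖rho n (γ⁻¹).1.1‖)
  have hFinv : ∀ x, F x⁻¹ = - F x := fun x => hinv x.1
  have hFl : ∀ a x, |F (a * x) - F x| ≤ L a := fun a x => hl a.1 x.1
  have hFr : ∀ a x, |F (x * a) - F x| ≤ L a := fun a x => hr a.1 x.1
  have hfin : ∀ C : ℝ, {x | |F x| ≤ C}.Finite := by
    intro C
    have hK : IsCompact ((fun g : Matrix.SpecialLinearGroup (Fin n) ℝ =>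
        (g : Matrix.SpecialLinearGroup (Fin n) ℝ ⧸ H)) ''
        {g : Matrix.SpecialLinearGroup (Fin n) ℝ | ∀ i j, |g.1 i j| ≤ Real.exp C}) :=
      (compact_box n (Real.exp C)).image continuous_quotient_mk'
    refine (hpd _ _ hK hK).subset ?_
    intro γ hγ
    obtain ⟨U, V, d, hU, hV, hd, hg, hlast⟩ := hsvd γ.1
    exact coset_lemma hn hodd H hH γ.1 (f γ.1) C hγ U V d hU hV hd hg hlast
  by_cases hex : ∃ g : Γ, ¬ IsOfFinOrder g
  · obtain ⟨g, hg⟩ := hex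
    refine ⟨Subgroup.zpowers g, abs1 F L hFinv hFl hFr hfin g hg, ?_⟩
    rintro _ ⟨i, rfl⟩ _ ⟨j, rfl⟩
    exact (Commute.refl g).zpow_zpow i j
  · push Not at hex
    have hlf : ∀ S : Finset Γ, Finite (Subgroup.closure (S : Set Γ)) := by
      intro S
      by_contra hinf
      have : Infinite (Subgroup.closure (S : Set Γ)) := not_finite_iff_infinite.1 hinf
      obtain ⟨g, hg⟩ := abs2 (G := Subgroup.closure (S : Set Γ)) (fun x => F x.1)
        (fun x => L x.1) (fun x => hFinv x.1)
        (fun a x => hFl a.1 x.1) (fun a x => hFr a.1 x.1)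
        (fun C => (hfin C).preimage (Subtype.val_injective.injOn))
        (Subtype.val ⁻¹' (S : Set Γ)) (S.finite_toSet.preimage (Subtype.val_injective.injOn))
        (Subgroup.closure_closure_coe_preimage)
      exact hg (Submonoid.isOfFinOrder_coe.1 (hex g.1))
    obtain ⟨C, hC⟩ := locfin_bdd Γ hlf
    have hF1 : F 1 = 0 := by
      have := hFinv 1
      rw [inv_one] at this
      linarith
    have hb : ∀ γ : Γ, |F γ| ≤ max (Real.log C) 0 := by
      intro γ
      have h1 := hFl γ 1
      rw [mul_one, hF1, sub_zero] at h1
      refine h1.trans ?_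
      rcases (le_max_of_le_left (norm_nonneg _) :
        0 ≤ max ‖rho n γ.1.1‖ ‖rho n (γ⁻¹).1.1‖).eq_or_lt with h0 | h0
      · refine le_trans (le_of_eq ?_) (le_max_right _ _)
        change Real.log _ = 0
        rw [← h0, Real.log_zero]
      · exact (Real.log_le_log h0 (max_le (hC γ) (hC γ⁻¹))).trans (le_max_left _ _)
    have hfinΓ : Finite Γ := by
      rw [← Set.finite_univ_iff]
      exact (hfin _).subset fun γ _ => hb γ
    refine ⟨⊥, inferInstance, ?_⟩
    intro a ha b hb
    rw [Subgroup.mem_bot.1 ha, Subgroup.mem_bot.1 hb]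
end
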